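/- arXiv:1111.5656 — 3 statements merged into one kernel-verified Lean document; each statement's English description precedes it below -/
import Mathlib

section
/- There exist a constant C and an integer n₀ such that for every integer n ≥ n₀ and every set P of n points in general position in the plane ℝ², the number of 5-holes of P is at least n/2 − C. Equivalently, X_5(n) ≥ n/2 − O(1). -/
open scoped Classical

noncomputable section

/-- A point in the plane. -/
abbrev Pt := ℝ × ℝ

/-- A finite point set is in general position if no three of its points are collinear. -/
def GenPos (P : Finset Pt) : Prop :=
  ∀ S ⊆ P, S.card = 3 → ¬ Collinear ℝ (S : Set Pt)

/-- A finite set is in convex position (its points are vertices of a convex polygon)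
if no point lies in the convex hull of the others. -/
def ConvexPos (S : Finset Pt) : Prop :=
  ∀ x ∈ S, x ∉ convexHull ℝ ((S : Set Pt) \ {x})

/-- `S` is a `k`-hole of `P`: a `k`-element subset of `P` in convex position whose
convex hull contains no point of `P \ S`. -/
def IsHole (k : ℕ) (P S : Finset Pt) : Prop :=
  S ⊆ P ∧ S.card = k ∧ ConvexPos S ∧
    ∀ p ∈ P, p ∈ convexHull ℝ (S : Set Pt) → p ∈ S

/-- The number of `k`-holes of `P`. -/
def numHoles (k : ℕ) (P : Finset Pt) : ℕ :=
  (P.powerset.filter (fun S => IsHole k P S)).card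

/-- `p` lies strictly to the left of the line through `x` and `y`, oriented from `x` to `y`. -/
def leftOf (x y p : Pt) : Prop :=
  0 < (y.1 - x.1) * (p.2 - x.2) - (y.2 - x.2) * (p.1 - x.1)

/-- `(x, y)` is a `j`-edge of `P`: `x, y` are distinct points of `P` and exactly `j`
points of `P` lie strictly to the left of the oriented line `xy`. -/
def IsJEdge (j : ℕ) (P : Finset Pt) (x y : Pt) : Prop :=
  x ∈ P ∧ y ∈ P ∧ x ≠ y ∧ (P.filter (fun p => leftOf x y p)).card = j

/-- Some line strictly separates `A` from `B`. -/
def SepByLine (A B : Set Pt) : Prop :=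
  ∃ u : Pt, u ≠ 0 ∧ ∃ c : ℝ,
    (∀ p ∈ A, u.1 * p.1 + u.2 * p.2 < c) ∧ (∀ q ∈ B, c < u.1 * q.1 + u.2 * q.2)

/-! ## A small clause checker -/

/-- evaluate the argument first (a device for kernel evaluation) -/
def frc {α : Type} (n : ℕ) (k : ℕ → α) : α := Nat.rec (k 0) (fun n _ => k (Nat.succ n)) n

/-- branching -/
def cnd {α : Type} (b : Bool) (x y : α) : α := Bool.rec y x b

def litX (a b c : ℕ) : ℕ := Nat.mul 2 (Nat.add a (Nat.add (Nat.mul 11 b) (Nat.mul 121 c)))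
def litH (n : ℕ) : ℕ := Nat.mul 2 (Nat.add 1331 n)

/-- negation of a literal -/
def lneg (l : ℕ) : ℕ := Nat.xor l 1

/-- bit test -/
def tb (F l : ℕ) : Bool := Nat.beq (Nat.land (Nat.shiftRight F l) 1) 1

def blt (a b : ℕ) : Bool := Nat.ble (Nat.succ a) b

/-- literal saying that the truth value of `X a b c` is not `s`. -/
def litN (s : Bool) (a b c : ℕ) : ℕ := cnd s (Nat.succ (litX a b c)) (litX a b c)

def gapX (u v : ℕ) (tl ks : List ℕ) : List ℕ :=
  List.rec tl (fun k _ ih => cnd (blt u k) (cnd (blt k v) (litN true u k v :: ih) ih) ih) ks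

def idx : List ℕ := [0, 1, 2, 3, 4, 5, 6, 7, 8, 9, 10]

def ord4 (a b c d : ℕ) : Bool :=
  cnd (blt a b) (cnd (blt b c) (cnd (blt c d) (blt d 11) false) false) false

def sClause (a b c d o : ℕ) : List ℕ :=
  cnd (Nat.beq o 0) [litN false a b d, litN true a c d, litN false b c d] <|
  cnd (Nat.beq o 1) [litN false a b c, litN true a c d, litN false b c d] <|
  cnd (Nat.beq o 2) [litN false a b c, litN true a b d, litN false b c d] <|
  cnd (Nat.beq o 3) [litN false a b c, litN true a b d, litN false a c d] <|
  cnd (Nat.beq o 4) [litN true a b d, litN false a c d, litN true b c d] <|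
  cnd (Nat.beq o 5) [litN true a b c, litN false a c d, litN true b c d] <|
  cnd (Nat.beq o 6) [litN true a b c, litN false a b d, litN true b c d]
    [litN true a b c, litN false a b d, litN true a c d]

def pClause (a b c d : ℕ) : List ℕ :=
  litN true a b c :: litN true b c d :: gapX a b (gapX b c (gapX c d [] idx) idx) idx

def beqB (s t : Bool) : Bool := cnd s t (cnd t false true)

/-- left end of the edge of the chain `s` over `x` -/
def edgeL (a b c d : ℕ) (tb tc td s : Bool) (x : ℕ) : ℕ :=
  cnd (cnd (blt d x) (beqB td s) false) d (cnd (cnd (blt c x) (beqB tc s) false) c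
    (cnd (cnd (blt b x) (beqB tb s) false) b a))

/-- right end of the edge of the chain `s` over `x` -/
def edgeR (b c d e : ℕ) (tb tc td s : Bool) (x : ℕ) : ℕ :=
  cnd (cnd (blt x b) (beqB tb s) false) b (cnd (cnd (blt x c) (beqB tc s) false) c
    (cnd (cnd (blt x d) (beqB td s) false) d e))

def hyps (a b c d e : ℕ) (t1 t2 t3 : Bool) (tl : List ℕ) : List ℕ :=
  cnd t1
    (cnd t2
      (cnd t3 (litN true a b c :: litN true b c d :: litN true c d e :: tl)
        (litN true a b c :: litN true b c e :: litN false a d e :: tl))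
      (cnd t3 (litN true a b d :: litN true b d e :: litN false a c e :: tl)
        (litN true a b e :: litN false a c d :: litN false c d e :: tl)))
    (cnd t2
      (cnd t3 (litN true a c d :: litN true c d e :: litN false a b e :: tl)
        (litN true a c e :: litN false a b d :: litN false b d e :: tl))
      (cnd t3 (litN true a d e :: litN false a b c :: litN false b c e :: tl)
        (litN false a b c :: litN false b c d :: litN false c d e :: tl)))

def between (a b c d e x : ℕ) : Bool :=
  cnd (blt a x) (cnd (blt x e) (cnd (Nat.beq x b) false (cnd (Nat.beq x c) false
    (cnd (Nat.beq x d) false true))) false) false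

def outX (a b c d e : ℕ) (t1 t2 t3 : Bool) (ch : ℕ) (xs : List ℕ) : List ℕ :=
  List.rec [] (fun x _ ih => cnd (between a b c d e x)
      (cnd (tb ch x)
        (litN true (edgeL a b c d t1 t2 t3 true x) x (edgeR b c d e t1 t2 t3 true x) :: ih)
        (litN false (edgeL a b c d t1 t2 t3 false x) x (edgeR b c d e t1 t2 t3 false x) :: ih))
      ih) xs

def sum5 (a b c d e : ℕ) : ℕ :=
  Nat.add (Nat.pow 2 a) (Nat.add (Nat.pow 2 b) (Nat.add (Nat.pow 2 c)
    (Nat.add (Nat.pow 2 d) (Nat.pow 2 e))))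

def hClause (a b c d e : ℕ) (t1 t2 t3 : Bool) (ch : ℕ) : List ℕ :=
  cnd (blt a 2) (hyps a b c d e t1 t2 t3 (outX a b c d e t1 t2 t3 ch idx))
    (litH (sum5 a b c d e) :: (hyps a b c d e t1 t2 t3 (outX a b c d e t1 t2 t3 ch idx)))

def tautC : List ℕ := [0, 1]

def dig (r k : ℕ) : ℕ := Nat.land (Nat.shiftRight r k) 15

def ne0 (n : ℕ) : Bool := cnd (Nat.beq n 0) false true
def neB (n m : ℕ) : Bool := cnd (Nat.beq n m) false true

def c2 (m n : ℕ) : List ℕ :=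
  cnd (neB m n && ne0 (Nat.mod m 16) && ne0 (Nat.mod n 16) && blt m 2048 && blt n 2048)
    [Nat.succ (litH m), Nat.succ (litH n)] tautC

def c3 (m n k : ℕ) : List ℕ :=
  cnd (neB m n && neB m k && neB n k && ne0 (Nat.mod m 64) && ne0 (Nat.mod n 64)
      && ne0 (Nat.mod k 64) && blt m 2048 && blt n 2048 && blt k 2048)
    [Nat.succ (litH m), Nat.succ (litH n), Nat.succ (litH k)] tautC

/-- The clauses, indexed by natural numbers. -/
def orig (f r : ℕ) : List ℕ :=
  cnd (Nat.ble f 3)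
    (frc (dig r 0) fun a => frc (dig r 4) fun b => frc (dig r 8) fun c => frc (dig r 12) fun d =>
      cnd (ord4 a b c d)
        (cnd (Nat.beq f 1) (sClause a b c d (dig r 16)) <|
          cnd (Nat.beq f 2) (pClause a b c d) <|
            frc (dig r 16) fun e => cnd (blt d e) (cnd (blt e 11)
              (hClause a b c d e (tb r 20) (tb r 21) (tb r 22) (Nat.shiftRight r 24))
              tautC) tautC)
        tautC)
    (cnd (Nat.beq f 4)
      (frc (Nat.mod r 2048) fun m => frc (Nat.div r 2048) fun n => c2 m n)
      (frc (Nat.mod r 2048) fun m => frc (Nat.mod (Nat.div r 2048) 2048) fun n =>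
        frc (Nat.div r 4194304) fun k => c3 m n k))

def nthC (db : List (List ℕ)) (n : ℕ) : List ℕ :=
  List.rec (fun _ => tautC)
    (fun c _ ih n => Nat.rec c (fun n _ => ih n) n) db n

def getC (db : List (List ℕ)) (h : ℕ) : List ℕ :=
  frc (Nat.mod h 16) fun f => frc (Nat.div h 16) fun r =>
    cnd (Nat.beq f 0) (nthC db r) (orig f r)

/-- are all literals of the list recorded as false? -/
def allF (F : ℕ) (ls : List ℕ) : Bool :=
  List.rec true (fun l _ ih => cnd (tb F l) ih false) ls

/-- `0`: conflict; `1`: no information; `l + 2`: the literal `l` is forced -/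
def scan (F : ℕ) (ls : List ℕ) : ℕ :=
  List.rec 0 (fun l ls ih => frc l fun l => cnd (tb F l) ih
    (cnd (allF F ls) (Nat.succ (Nat.succ l)) 1)) ls

def setL (F l : ℕ) : ℕ := Nat.lor F (Nat.pow 2 l)

def maskOf (ls : List ℕ) : ℕ :=
  List.rec 0 (fun l _ ih => setL ih l) ls

def rup (db : List (List ℕ)) (hs : List ℕ) : ℕ → Bool :=
  List.rec (fun _ => false) (fun h _ ih F =>
    frc (scan F (getC db h)) fun r =>
      cnd (Nat.beq r 0) true <| cnd (Nat.beq r 1) false <|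
        frc (setL F (lneg (Nat.sub r 2))) ih) hs

def check (ss : List (List ℕ × List ℕ)) : List (List ℕ) → Bool :=
  List.rec (fun _ => false) (fun s _ ih db =>
    cnd (frc (maskOf s.1) (rup db s.2)) (cnd s.1.isEmpty true (ih (s.1 :: db))) false) ss


def cert : List (List ℕ × List ℕ) := [
([2611,2635,4646,4614,3654,3926,3158,4366,3870,2910], [694386,690018,9991763,1673057,2721633,484674,690002,9991747,26768979,1664321,9851955,344866,484658,480306,9847587,42427715,91640883,9987107,480034,40190755]),
([1304,1812,1570,2102,2368,4598,3158], [74863667,1463345,2511921,9991731]),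
([2367,2635], [694386,1673057,694370]),
([1038,1546,1304,1836,2102,3630,2910], [1393441,2442017,73745187,8873251]),
([1280,1039,1546,1569,1813,1571,1836,2369,4646,3606,3158], [274962,414770,624482,2651729,1603153,7680531,5447939,1389073,2437649,72626707,41309235,274946,270594,620098,475938,624450,484386,22225155,8630055443,77100627,8632362035,9982211,42357523]),
([1281,1547,2076,1305,2344,2100,1837,2102,2634,4614,3638,3158], [480306,2651457,1602881,484658,344866,484674,4539169,340498,480034,484642,4399363,1323537,2372113,91640883,4337394995,336130,77100611,4335153683,11109395,42353427]),
([1812,4598,3638,3158,2910,1039,1304,1837,3654,2369], [484674,1463345,274962,6631955,6636307,2511921,620114,624466,694386,624482,74863667,2577457,1602881,42427715,1603121,2651697,25650483,7746067,77100595,2651185,23413539,11109139,344594,484642,25576211,2187674131,336130,1253633,2302209,71508227,6636291]),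
([2076,2007,2005,1835,3150,3358,1281,1037,1039,1837,2102], [484674,25576227,2511905,2239124515,344594,484642,479762,25576211,2187674131]),
([1303,2343,1521,1835,3150,1281,1039,1837,2369], [484674,344594,619810,40120851,2239124515]),
([1812,2911,1039,1304,1837,2369], [624482,484674,2511921,15468484,8873011,61081540,31721412,15992772,14419908,8128452,7997380,15075268,11405252,1463345,274962,6631955,6636307,620114,624466,694386,74863667,17188738099,1603121,8872723,25650483,7746067,77100595,25650227,11109939,11109139,9974291,16,42427715,5867073,63367022533,17256969539,0,1463329,2511905,2222347299,25649955]),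
([1521,2077,2911,1039,1304,1837,2369], [484674,0,480290,2511905,1463329,619842,624482,2511921,15468484,8873011,12322756,8803379,61081540,15992772,7735236,6162372,1463345,274962,6631955,6636307,624466,694386,1454609,2154119699,40186387,270594,475666,480274,1253633,2302209,17271440163,2170896915,42427699,73605379,11109939,8872707,11035395,5867089,6915665,93877843,91640611,1738593,6981201,118144108485,126734043077,66600830917,66628093893,19418923539,68747359827,61441619,110650691,685074,85994337603]),
([2074,2077,2911,1039,1304,1837,2369], [484674,1463345,624482,274962,2511921,0,8872723,3551761,414481,410385,16,480290,1463329,619842,15468484,8873011,12322756,8803379,7735236,6162372,6631955,6636307,620114,694386,9986835,11035411,8794643,8794371,1598225,2646801,42353427,42357523,75981587,25571859,5867089,6915665,93877843,1738593,6981201,91640611,2302209,88285443,5517569,6566145,118144108485,126734043077,66600830917,66628093893,68747359827,274946,270594,475650,61441619,110650691,39072275,17271440163,85994337603,74863379,685058,77100563,19955794435,11108611,577057283,25571587]),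
([1787,1302,1813,1835,1037,1039,1568,1304], [274962,475666,39072275,6631683,2302209,88285443,475650]),
([2911,1039,1304,1837,2369], [484674,1463345,274962,6631955,6636307,2511921,620114,624466,694386,624482,6162372,11405252,12322756,14419908,15468484,44828612,15992772,24381380,61081540,8803379,8873011,48,619842,480290,624450,475938,2511905,1602609,2651185,17222292531,0,17271440163,42427699,11109939,16,6915665,93877843,68762953011,11035699,25576227,118144108485,131029010373,1738593,5932625,11022867,17224533843,44664371,685378,68814468691]),
([1813,1835,1039,1304,1837,2369], [0,484674,1463345,274962,6631955,6636307,2511921,624466,694386,624482,619842,480290,624450,475938,23413539,16,8794643,1454609,2503185,73675283,73740819,6496515,2651169,1598769,274946,270594,23273731,39072275,8872195,74863379,17271440163,10357700,22809540,28576708,17272488739,75911955,11109907,11034883,110650675,5867089,6915665,93877843,6981201,85942817843,118144109509,68747359827,694082]),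
([2075,1812,1304,2100], [1602881,2577457,1528881,42427443,42427699,15998340]),
([2078,1812,1039,1304,1837,2369], [484674,1463345,274962,6631955,32,624482,2511921,624466,0,8794643,23413539,484642,344594,1602881,2577457,2651185,1528881,2651441,1602865,2651457,620114,694386,1598785,8803379,12326724,12324740,31725444,2173064227,74863667,42218003,77100595,11109139]),
([3655,2007,2005,4647,2367,2296,2342,1835,1281,1037,1039,1837,2102], [66588251589,66588249925,66600836869,144,110650691]),
([4598,3158,2367,2342,1835,1039,1304,1837,2369], [48,74863667,16,93877843,2716993,624466,32,1602881,2577457,2651185,1528881,2651441,1602865,64,484674,1463345,274962,6631955,6636307,2511921,620114,694386,624482,77100595,11109139,9974291,0,42427715,176,15996356,15994692,160]),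
([3158,2367,2342,1835,1039,1304,1837,2369], [64,32,93877843,484674,1463345,274962,6631955,80,624482,2511921,624466,48,8794643,23413539,484642,344594,1602881,2577457,2651185,1528881,2651441,1602865,6636307,620114,694386,74863667,8872723,40120851,0,31723332,31733124,66588261509,66596650117,2239124515,42427715,68762953027,479762,77095987,2187674131,11109139,25576211]),
([2367,2342,1835,1039,1304,1837,2369], [80,48,624466,64,1602881,2577457,2651185,1528881,2651441,1602865,484674,1463345,274962,6631955,6636307,2511921,620114,694386,624482,93877843,0,8132036,8130372,28053380,66588249989,66596638597,42427715,68762953027,77095987,11109139,9974291,192]),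
([507,1809,1832,1301,1303,1039,1304,1837,2102], [484674,274962,6636307,1463345,6631955,484642,479762,2187674131,344594,2511921,274946,344578,479746,88285443,2236883203,8872707,40120579]),
([506,1014,772,1304,1570], [1253633,2302209,71508227,6636291]),
([1832,1835,1039,1304,1837,2369], [144,484674,624482,1463345,2511921,274962,624466,128,112,8794643,23413539,344594,6636307,0,344578,88285443,8794371,23413523,40120851,6631955,484642,336130,2187674131,1602881,2577457,2651185,1528881,2651441,1602865,620114,694386,16,2239124515,1602849,15339332,31723332,2206688291,77100595,25576211,11109139]),
([1835,1039,1304,1837,2369], [160,484674,1463345,274962,6631955,6636307,2511921,624466,694386,624482,144,128,8794643,23413539,344594,16,344578,88285443,8794371,0,74863667,8130372,61083524,240,11109939,48]),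
([1039,1304,1837,2369], [484674,2511921,620114,624466,694386,624482,176,0,4678977,1603137,2651713,8873011,2651457,2647089,15470468,59514244,15998340,31726980,11109427,288,77100611,65514511749]),
([1304,1837,2369], [624466,484674,694386,624482,1463345,2511921,0,5517843,6636323,1393441,2442017,1458977,2507553,205058,6162372,7210948,11405252,7735236,15075268,12191684,15861700,60950468,8128452,1463329,6636051,8803363,8872739,6627587,7750435,8799011,74863667,22295059,619842,274690,475922,480274,17254662947,1097155347,42427683,40050947,11109923,8790275,8872451,11035139,5867089,6915665,93877843,23409171,74863395,1738593,5932625,126734043077,131029010373,66600830917,66628093893,18345181971,17224533843,61441619,110650691,685074,85994337603]),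
([3543,1810,2073,1280,1835,2098,1812,1038], [14420932,14425412,17221108515,42427427]),
([1810,2077,2073,1280,1835,1812,1038,2100], [2651457,1602881,0,17205515315,75907875,11406276,15340996,17221108515,42427427]),
([1546,1835,1305,2100,1837,2102], [480306,344866,484674,6566419,1458977,2507553,205058,340498,344850,414753,6562051,23343635,8872467,8790275,1598497,0,480018,89403923,74863651,17188738083,14290756]),
([1498,1302,1544,1522,1566,1280,506,1812,1038,2100,2102], [1528865,8872467,8790275,74863651,42427683,15863620]),
([1811,1544,506,2077,1837,2369], [484674,64,344866,6562051,484658,4399363,340498,2511649,1463073,344850,624466,480306,42427715,2651457,550209,694386,624482,619826,480018,89403923,1113932563,6636035,2372097,37953795,480002,0,23413267,1163145475,40116483,8872451,74863651,12193604,60952388,66588249925,75912227,93877843,11109923]),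
([1810,2075,1547,1835,2100], [91640883,4337394995,15994756]),
([506,2077,1835,1837,2369], [624482,624466,96,48,6775857,5727281,5792817,0,624434,480306,2651457,550209,484658,344866,484674,4399363,340498,471570,16,2511905,40190755,14026692,12191684,21517259555,92689443]),
([2077,1835,1837,2369], [624482,624466,112,64,480306,2651457,484658,344866,694386,550209,42427715,5792817,16,619826,1668417,0,480034,205058,2511649,1389073,72626707,4301599251,1323537,2372113,1454609,2503185,1463057,17188738067,11109907,93877827,93877843,66603982597]),
([1811,507,1835,1837,2369], [624482,484674,128,344866,0,205058,2372113,8798739,6636051,1323537,624466,80,6775857,5727281,480306,2651457,1602881,484658,620114,694386,480034,619826,1463073,2511649,1389073,72626707,4301599251,40190755,1454609,2503185,1463057,6635779,74863635,8803347,17188738067,2642961,1594385,9987091,11035667,25575955,25576211,75981843,11405252,7997380,28575684,55838660,2371841,21176579,11040275,77100563,5867089,6915665,93877843,5932625,91640867,344834,480002,11108611,126734043077,131029010373,17224533843,626274819,25575683,25436419,61441619,577061379,42353443,22103273987,4405617971,684802,90289304883]),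
([507,1835,1837,2369], [16,624482,624466,144,96,5727281,480306,2651457,1602881,484658,344866,620114,484674,694386,205058,1323537,2372113,8663571,6636051,8798739,0,91640883,48,8128452,8130244,28053380,24383364,40190755,340482,484642,336130,21176579,4335153683,8798467,42353427,73675283,11109395,4386607907,1672769,93873203,619810,73057920307]),
([1810,1835,1837,2369], [160,484658,344866,0,4399363,340498,2511649,1463073,344850,32,624482,624466,112,480306,2651457,1602881,620114,484674,694386,91640883,2651441,64,1528609,8128452,8132036,8141892,1594145,2642721,1598241,42353443,1602849,40190755,8790275,8659203,8798723,37953795,340226,18294850323,1113932563,91636243,25575955,77100579,11108883]),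
([1015,2074,1835,1837,2369], [176,344866,16,4399363,340498,484658,3695921,1594145,0,480018,2511633,1598225,2511649,1598241,624482,624466,128,6775857,5727281,624434,471570,2650913,1602337,1463057,619826,1463073,344850,48,480306,620114,484674,694386,56967699,89403923,1113932563,59130387,8798723,8790275,25575955,2372097,37953795,23413267,11108883,480002,1672737,1163145475,40116483,8872451,74863651,12193604,27922244,8803363,77095971,93877843,68762953027,66596638533]),
([2074,1835,1837,2369], [192,484658,344866,32,4399363,340498,2511649,64,624466,480306,2651457,1602881,484674,624482,0,8798739,8659203,40190755,42353443,11405252]),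
([1014,1835,1837,2369], [208,484658,0,1598769,344866,48,4399363,32,480018,619826,340498,2511649,1463073,344850,80,624482,624466,160,6775857,5727281,484674,694386,6636051,8798739,1319169,2367745,71508227,40190755,4318376467,8798467,7997380,28575684,55838660,73670915,40190483,91640867,9987075,11035651,21566403091,5867089,6915665,93877843,4405617971,1738593,6981201,118144108485,126734043077,68747359827,61441619,684818,90289304883]),
([1835,1837,2369], [624466,224,480306,2651457,484658,344866,620114,484674,694386,624482,176,5727281,6775857,96,64,4399363,340498,344850,1463073,2511649,48,619826,624434,480018,471570,1463057,1602337,2650913,16,1598769,0,56967699,89403923,1113932563,2647073,1598497,8798723,8790275,1594401,25575955,2372097,37953795,23413267,11108883,480002,1672737,1163145475,93877843,40116483,8872451,74863651,27922244,66596638533,77095971,68762953027]),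
([1544,1015,1833,506,1834,2098,1305,1837,2102], [344866,4399363,344850,2651713,484658,484674,2647073,8798723,1532961,2581537,554017,37953795,4678433,4678945,8855811,340226,24527379,1113932563]),
([1015,2075,506,1834,1305,2100,1837,2102], [2651697,2651713,1598513,344866,4399363,340498,480306,1602881,484658,484674,0,2511905,40190755,89403923,15992772,480018,4337394995]),
([2075,506,1834,1305,2100,1837,2102], [484658,344866,4399363,340498,2511649,1463073,2651713,484674,1598513,0,7750163,1319169,2367745,71508227,40190755,8872963,15992772,73670915,4337394995,4318376467,480018]),
([1014,2074,1280,506,1834,2054,2098,1568,1038,1570,2102], [2511649,2651713,7750163,8659203,40190755,42353443,11405252]),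
([1545,506,1837,2369], [624482,484674,304,344866,484658,624466,480306,1602881,2651457,64,4399363,340498,16,0,2511649,344850,620114,2717249,2651713,694386,410401,2511905,40190755,90452499,5587473,6636049,89403923,7210948,11405252,340226,42353443,37953795,9978371,8864259,11026947,1672769,77100611,41304867,1738561,65527089093,117069842373,125659776965,118143584197,5460349715,77096259,68730582595,44664387,685330,68814468691]),
([506,1837,2369], [624482,80,2651713,624466,320,480306,2651457,1602881,484658,344866,620114,484674,4399363,340498,344850,1463073,2511649,32,3695921,1598241,2646817,1594145,554529,16,0,2647073,8872995,1532961,64,31595844,15473988,77100579,25650227,9969923,25440787]),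
([1837,2369], [694386,624482,484674,624466,620114,336,344866,484658,480306,1602881,2651457,96,2651713,0,205058,6566419,1323537,2372113,8663571,6636051,8872979,73675283,40190739,4301599251,340482,484642,336130,21176579,1323521,2372097,4335153683,8864003,8872963,73675011,41304851,4384301315,479746,4386607907,1602849,15077060,8130244,12324548,15994564,4354171683,672,25580595,42353427,66603978437,117069844165,125659778757,11026691,68730582595,11109955,694098,93877843]),
([2031,1568,2369], [0,2581809,624482,1603153,25646131,4303840563,15997828]),
([1570,1568,1834,772,2369], [0,624482,2651713,1603137,16,2651729,2647361,8663571,344866,7754803,8873267,15994756]),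
([1568,1834,507,2369], [205058,624482,32,2651729,0,414770,8803091,5517843,414754,270594,39072275]),
([1039,1834,507,2369], [0,624482,2651713,205058,48,2651729,1603153,344866,270594,1463345,414754,410402,1393169,2441745,39072275,8873235,8868627,73745171,41309235,8128452,12324740,42357811,8729107,8728835,90522403,88285443,410114]),
([1834,507,2369], [205058,624482,64,2651729,16,0,5517843,1323537,2372113,414770,414498,8803347,72626707]),
([1280,507,2369], [80,0,1533249,205058,414770,5517843,484386,270594,414754,39072275,7754515,8630055443,484402,1393169,624482,2441745,8873235,73745171,73740819,274946,7824705,624450,620098,2651729,1603153,694386,8729107,22225155,1389057,2437633,344321,8868099,8873219,41308947,73740547,88285443,475650,8681571107,1602593,15076804,8129988,12324292,15470020,8649138979,42357811,784,42357523,66603978181,118144110021,126734044613,11030787,68730582611,11109971,694082,8683812419]),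
([2341,507,2369], [96,205058,16,1533249,414770,5517843,270594,414754,39072275,7754515,484386,0,90522403,620098,624482,2651729,694386,1393169,1603153,2441745,484402,8630055443,7824705,475938,624450,15468484,8632362035,42357523,11109651,77100627,118144108485,15992772,7210948,8873235,73740819,619554,694082,8681571107,68730582611,25650483,11031315]),
([507,2369], [624482,112,2651729,1603153,694386,205058,32,1533249,484402,620098,7824705,414770,1668689,2717265,624450,5517843,274946,270594,484386,414754,475938,1393169,2441745,39072275,1602609,2651185,8873235,8868627,7754515,1462801,73740819,73745171,8630055443,16,90522403,10356676,7210948,7735236,12191684,12322756,15468484,24381380,60032964,58086179,8632362035,42357523,1598225,2646801,554257,3691025,11109651,3691537,1672785,77100627,100964239301,118144108485,126734043077,66600830917,66603976645,66629142469,11040339,0,8683812419,42357811,2189841443,8728835,11031315,88285443,5517569,6566145,44664403,68730582611,475650,484354,685634,8681571107,2774876675,68797691475,1734225,41308947,68746175795,579154435,77100307,8868099,44664115,11108611,11022867,581456643,25506051,25510691,685313,644166147,93873475,11365925379,77404403267,5927937]),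
([1278,1835,772,1569,2369], [0,4399363,344866,5447939,1463345,484386,90522403,15337412,11929540,7824705,624450,6705953,5657377,410402,2302209,624482,128,2651729,1603153,8728835,1388801,2437377,39002371,72626435,59134755,8873219,10779845667,73740547,475666,8630055443]),
([1835,772,1569,2369], [16,4399363,344866,5447939,6705953,5657377,1463345,414754,410402,2302209,5517571,1253633,624482,144,2651729,1603153,694386,620098,7824705,484386,2717265,624450,475938,90522403,1602609,2651185,10356676,7210948,7735236,15468484,15992772,60032964,8632362035,0,107295251,39072275,475666,484370,8681571107,2238005779,25650483,72556803,11109683,8593667,11031299,8868611,1672785,77100627,25510691,1738577,58086179,118144108485,126734043077,66600830917,66629142469,93873475,10829054483,68730582611,44664403,77404403267,685074]),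
([1544,772,1569,2369], [624482,32,4399363,344866,1463345,410402,0,1532977,1603121,2651713,2647089,1598513,1603137,414754,5447939,160,1603153,90522403,2647073,10356676,14026692,7997380,92619555,2188792867,8593667,25645859]),
([772,1569,2369], [48,176,624482,4399363,1253633,2302209,344866,1463345,410402,414754,0,410130,1319169,2367745,71508227,1393169,2152997123,1393153,2441729,2441473,73745155,8873219]),
([3639,1832,2029,1522,1280,1303,2369], [624482,192,1603153,15994564,15997764,4336276259,25646115]),
([1832,2029,1522,1280,1305,1303,2369], [624482,208,2651729,1603153,0,4320617779,42287907,7738308,14291908,4336276259,25646115]),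
([1014,1569,2369], [32,274962,96,624482,224,2651729,5513475,1319169,2367745,71508227,1393441,414770,414498,7754801,1533249,1598785,2647361,8803331,406034,1603137,8659203,72622339,0,484114,4385485331,4303840547,25580579,15865668]),
([1303,1015,773,1569], [274962,1393441,89403923,414482]),
([1570,1569,2369], [64,274962,16,0,3490593,256,624482,1463329,7754787,8873251,15863620]),
([1566,1569,2369], [0,414770,80,274962,32,16,3490593,144,624482,272,2651729,1603153,8873251,8802835,7754243,15866564,8134212,22295059,8868643,274690,410386,39002371,41309235,1164264211,484370]),
([3631,1569,2369], [0,16,414770,96,274962,48,32,3490593,160,624482,288,2651729,1603153,15861700,15864772,15865668,15474244,73745187,8733475,484402,410386,1603137,2651713,22295059,8724739,75842339,42357795,8615584819,8680387091,484114]),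
([1544,2051,1522,1834,3630,2102], [1532961,25650467]),
([3103,1832,2055,2051,2076,2098,1038,2102], [7214020,15470020,75842339,8615584819]),
([1547,1569,2369], [32,64,414770,144,274962,96,80,3490593,208,624482,336,2651729,1603153,484402,410386,406034,1603137,2651713,22295059,8724739,7676163,1594401,1528865,16,8680387091,484114,0,8631239459,42423331,14291908,15473476,75842339,8615584819]),
([1256,1569,2369], [352,160,274962,80,414770,48,624482,0,1072,6162372,7684899,8128452,1603153,112,96,3490593,14026692,8868643,41309235,624450,15468484,11929540,2507553,1458977,64,224,2651729,8724739,1384705,2433281,72556803,72622339,42357539,8873219,8632362035,73736451,475922,8613278227]),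
([1569,2369], [240,624482,368,2651729,1603153,694386,176,274962,128,112,3490593,96,414770,80,64,16,1088,2507553,6162372,10356676,7735236,11929540,14026692,8128452,15468484,7684899,8733475,8868643,41309235,620098,624450,2717265,0,22295059,90518035,274690,484370,475922,1164264211,8632362035,39002371,42357539,8868355,9982467,11031043,41308963,1672785,77100627,1738577,9755312915,118144108485,126734043077,66600830917,66629142469,68730582611,44664403,93873475,685074,77404403267]),
([1280,1302,2369], [624482,384,0,1533233,1603121,368,2651729,2647345,1598769,256,1463073,2642721,8873251,8593667,15863492,15863620,274962,7754531,7754787,414770]),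
([1302,2369], [624482,400,16,1533233,1603121,384,2651729,2647345,1598769,2581809,272,1603153,0,4539169,3490593,3560497,8873267,274962,8872723,15996612,15997636,15994692,15994756,1253633,2302209,8868627,8593667,2507537,7754803,8868611,39072275,25580323,25645859,410130,72556803,2188792867,2238005779,484370]),
([772,2369], [0,288,4399363,344866,344594,414754,832]),
([1281,773], [274962,340498,2442017]),
([2369], [624482,448,1603153,2651729,320,64,2581809,432,32,16,274962,1590049,0,1393441,6837281,1463073,414770,344850,5723185,554305,550209,1533249,8659203,89403923,340226,37953795,8798723,8864259,40190755,24532003,7997380]),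
([1836,2102,1570], [0,2721633,9991763,8873283,9921859,66596642565]),
([1834,1810,1812,2102,1012,1568,1570,773], [16,32,2511649,1463073,274962,205058,1603137,2651713,7750147,1673025,3700033,40190755,9978371,7735236,15337412,25650211,4369830691]),
([1545,1835,1810,1568,1280], [2511649,410401,40190755,91640883,8128452]),
([2634,6406,1546,2098,4894,2054,2344,2366,1570,1038], [48,1673025,1742961,1742945,2791521,27887171,2791265,10896163]),
([2102,1015,1303,1305,773], [64,344850,89403923,340226,37953795,80,272,2511649,1463073,6636049,5587473,414770,274962,205058,1673057,2721633,48,480306,480018,2577185,32,16,8798723,23339267,1458689,2507265,40120835,73744899,9847299,1598785,9991683,9921027,9986563,1664321,1532673,74859011,848,1524513,17271370259,17221108515,545554,545842,19794884,36572100,13503428,14027716,30542788,8129476,30149572,2642721,21550813987,17289397027,21501605155,91640883,1673025,2721601,26768963,5854241,23343635,117069843397,125659777989,65522895813,131028487109,9838851,43476291,76956451,17206637619,22641333011,0,690002,689426,1738593,2787169,17274865491,694113,27883075,10896163]),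
([2635,2049,2076,2321,2079,6438,6534,6150,2054,2101,2341,1788,5022,2103,1279,1257,1301,1570,1038], [624210,2721345,554578,1533249,1668673,2581825,689426,690018,1738049,34454734419,94996291,44660291,10961699]),
([4615,2362,2054,1521,2103,1279,1257,1301,1568,1305,773], [96,554578,112,2581809,414770,344850,340226,37953795,205058,274962,1533249,7750147,40190755,6162372,41239331,1463073,2581793,2511649,1533233,2581281,1533217,2581825,8128452,24532019,24392211,9904387,30017476,9991203,1602881,9912835,12322756,38668228,11405252,410401,65514506181,65522894789,117069842373,129954744261,126733518789,75982147,624210,545554,77030723,34452427827,43545635,34402091811,39821136659,0,1742961,2791537,27887427,10961699]),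
([2076,4614,2054,2095,2341,2099,3414,3486,2103,1568,1570,1038], [43546179,75973411,624210,34385318963]),
([2077,2101,3414,1547,2103,1279,1305,773], [414770,1598785,34452427827,545554]),
([2054,1521,2103,1279,1257,1301,1568,1305,773], [144,160,2511649,414770,344850,340226,37953795,205058,274962,554578,1533249,7750147,410401,40190755,12322756,2581825,30017476,2581809,6162372,41239331,9991203,1602881,0,1463073,1533217,2581793,1533233,2581281,2572801,9990659,9912835,13502404,75973411,16,34385318963,32,624210,1672769]),
([1015,1303,1305,773], [160,344850,414770,176,274962,205058,368,5587473,6636049,89403923,2511649,340226,37953795,80,554578,1533249,2581825,2581809,7750147,410401,90452499,40190755,6162372,30017476,12322756,41239331,9991203,1602881,16,0,3695937]),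
([2055,2101,1305], [414770,2647361,545842]),
([1568,1789,1836,1545,1280], [40190755,24532019,8128452]),
([3639,2074,2101,2099,1522,2078,1787,1303,1280], [15996612,15997764,38697063203,92754979]),
([2074,2099,1522,2078,1787,1836,1303,1305,1280], [414770,2581825,1602881,0,4387726643,41239331,11930564,14289860,38697063203,92754979]),
([2099,2103,1303,1305,773], [274962,414770,205058,64,6562051,1458977,256,554578,1533249,2581825,7610627,1524513,32,406034,550194,71508227,1319169,2367745,7754755,72622339,5796897,0,549650,4385485331,24532003,4370949411,15863620]),
([1566,2271,1764,1830,2078,1787,1836,1280], [256,2581793,24532003,30019396,15863620,26768419,4370949411]),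
([2103,1303,1305,773], [272,274962,414770,205058,96,6562051,1458977,71508227,2367745,1319169,288,554578,1533249,2581825,7754755,7610627,72622339,1524513,64,550194,414482,406034,554546,1598785,1532705,2581281,16,2647361,1673025,2721601,9991171,3769665,3769921,9707779,0,4385485331,405762,549650,4333969667,2646817,41239043,4336276259,7735236,7742404,7742916,14028484,15077060,52039364,27922116,30543556,8130244,20713156,24383172,4404499235,12960883491,1673041,2721617,9991491,4321735971,3769937,43336483,97741442757,114921311941,123511246533,65529188037,99888926405,66602929861,100962668229,131027439301,63367024325,4321666355,11105603,11109699,5936993,1504,137466771027,137466771011,137449993539,1738561,2787137,78219091,2778433,10756355,27874339]),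
([1810,1812,1568,2102,1545,1012,1570,773], [304,256,240]),
([1787,1763,2051,2079,1811,3518,3102,1568,1303,773], [320,2511649,274962,1524513,41304867,471570,21517259555,553746]),
([1303,1305,773], [320,414770,336,274962,205058,144,1319169,2367745,71508227,6562051,1458977,32,1673057,304,484658,480306,1463073,2511649,40190755,7210948,14026692,7997380,12191684,16,554290,480018,4318376467,4368572675,73670915,1450241,2498817,414465,8872963,9991683,9987075,91640867,74863619,1598785,92689443,72622339,21566403091,0,6775841]),
([1811,2102,1305,773], [336,0,414770,320,480306,1528865,205058,274962,5513475,344850,6636035,37953795,340226,484658,1113932563,2721633,1673057,2372097,352,1463329,3560225,2511905,554290,480002,1088,23413267,1163145475,40116483,9921027,9986563,74863651,42427683,15863620]),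
([1831,1499,1810,1786,1812,1278,1015,1036], [484385,91636243,18294850323]),
([2100,2102,1305,773], [368,16,384,32,414770,352,480306,1528865,3625761,2577441,205058,274962,5513475,344850,6636035,37953795,340226,484658,1113932563,1463329,3560225,2511905,1120,1602849,23343635,0,9991715,9990675,8141892,24527379,91640883]),
([1830,1810,1764,1786,1808,1542,2102,1522,1544,1566,1036,1570], [384,1603105,9991715,8872467,9990675,8141892,23343635,24527379,91640883]),
([2102,1305,773], [400,344850,274962,414770,205058,64,6636035,37953795,340226,416,1463329,3560225,2511905,5513475,1673057,2721633,384,484658,480306,1113932563,1528865,2577441,3625761,48,16,208,0,74863651,32,14290756,31592260,9838851,17255846947,26768931]),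
([1740,1305,773], [416,0,274962,80,414770,554578,7754787,12193604,2581825,14290756,8868899,224,34435650595,432,1463329,3560225,1533217,3629857,31592260,15863620,2511905,1533249,2581537,2581793,205058,9990675,9904387,75982115,43546147,624210]),
([1305,773], [432,448,274962,205058,414770,344850,96,5513475,1463329,2511905,6636035,3560225,37953795,340226,16,554578,1533249,2581825,7754787,1533217,2581793,2581537,22679364,30019396,15863620,63049540,3629857,9917475,9991203,0,24527379,1113932563,550194,75982115,75982147,11110179,66588249925,1632,43546195]),
([1570,1836,773], [274962,0,1393441,7754803,7754787,8130372]),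
([1543,1810,1786,1764,1566,2103,773], [464,554578,0,550210,2647329,16,274962,1393441,480,205058,6627587,22295059,5513475,414738,410386,274690,2581793,1533217,5517827,409858,549906,1112813827,24457731,9990659,554273,75982115,15866564,12328516,75977507,34402096179]),
([1810,1786,1764,1566,2103,773], [480,554578,16,554562,32,274962,1393441,496,205058,6627587,22295059,410386,1532977,2581553,7754243,274690,39002371,550210,0,1164264211,7754531,29757124,15994564,9990947,75982131]),
([1566,1544,2103,773], [496,274962,3556129,554578,32,554562,205058,48,1393441,5513475,512,6627587,7754243,1533217,2581793,22295059,3629857,3630113,274690,39002371,410386,0,2581809,41309235,1164264211,8141380,14421892,549906,9991459,2647089,109532211]),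
([3159,1544,2103,773], [0,554578,48,554562,274962,64,1393441,528,205058,8128452,8130372,73745187,41309219,410386,7676163,22295059]),
([1547,1544,2103,773], [528,274962,554578,64,554562,2581537,3621665,1532961,550210,80,1393441,544,205058,549938,410386,2647073,22295059,7676163,41309219,14290756,15339332,30543684,109532195,8665916451,1673041,2721617,26768675,3769937,9773315]),
([2076,1813,2343,2101,1808,2911,1546,1830,1786,2078,773], [544,12322756,63047620,14026692,274962,3621665,96,560,34402096179,92759363,75977507,66588248005,11110179,43546195,1744]),
([2635,1544,2103,773], [560,274962,3556129,48,414497,16,554578,112,1393441,576,205058,32,96,554562,41309235,1528609,7676163,90518035,73745187,28575684,550210,2581537,1532961,14026692,8868643,22415300,9917219,6162372,7684899,0,624194,1672785,2721361,3621665,5513475,22295059,549906,1164264211,24457747,9904387,77026083,34386502963,44116099859,28444612,11405252,5797185,6845761,541458,43025580835,34386502947,43546195,131029010373,126734043077,55707588,690018,689170,689730,5932353,34437957203,94996307,44660003,10952963]),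
([1544,2103,773], [576,554578,112,550210,554562,205058,274962,128,1393441,5513475,592,3556129,64,2581537,1532961,414497,48,32,73745187,41309235,6162372,14026692,22415300,1528609,8868643,9917219,7684899,7676163,22295059,274690,16,624194,549906,1672785,43546195,1164264211,131029010373,39002371,0,1742961,2791537,27887443,10965507]),
([3359,2099,1813,1809,2074,1834,1038], [11406276,15472068,74793763,8682693683]),
([2101,1813,1809,1522,2074,2076,1834,1038], [5797185,6845761,0,42992026403,109532195,14289860,15473476,74793763,8682693683]),
([2103,773], [624,205058,274962,176,1393441,5513475,640,554578,160,554562,550210,32,1458977,8680387091,5653009,6701585,4609073,549938,410386,554546,4608785,405762,549650,406034,2442001,22295059,1532705,2581281,37953795,1079259395,2646817,1388801,2437377,7676163,72622339,7684611,1528609,0,1673041,2721617,9991427,8733187,3769937,9773315,74793475,9781763,1524513,8631239459,8681435667,13503940,15076804,26873284,52039108,30019012,8699462435,12960883491,1673025,2721601,26768707,8616703011,43537443,3769921,129953697221,131027439045,8632353571,11110227,14051402515,690018,689682,1738577,2787153,78219091,8668153667,2786897,10821891,44651555]),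
([1547,1571,773], [640,0,484674,1603153,1673041,2721633,2717265,1668689,2651729,9991763,274962,192,1393441,656,205058,484402,410386,22295059,8724739,9773315,1594401,1659937,25650499,26699075,66596642565]),
([1256,1809,1571,773], [274962,0,484674,2581793,73745187,7210948,8597685027,15861700,208,1393441,1528865,2507553,1458977,16,2651729,1603153,672,205058,1384705,2433281,72556803,72622339,8724739,8873219,25650467,73736451,8664793891,8613278227,475922]),
([1809,1571,773], [672,274962,16,2507553,1458977,32,484674,1603153,1673041,2651729,205058,224,1393441,5513475,688,1528609,1528865,2581793,2581809,73745187,7210948,15861700,8597685027,0,22295059,274690,484370,475922,1164264211,8664793891,39002371,25650467,9982467]),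
([1571,773], [688,48,274962,240,1393441,704,484674,1603153,32,0,9991459,30541764,30547524,1872]),
([773], [704,205058,274962,720,256,1393441,5513475,64,1673057,0,1463345,6636323,2511921,1463329,2511905,240,2511649,6162372,7210948,15861700,8128452,31721412,6627587,7750435,1920,22295059,475922,554306,274690,480274,17254662947,1097155347,42427683,40050947,9986563]),
([1304,1570,1280], [0,6631955,1463345]),
([1570,1280,2102], [736,16,72626707,2437649,1389073,720,1463313,2511889,3560209,3559953,9991699,0,344866,6636305,480306,2372113,74863635]),
([1520,1280,2102], [752,32,0,484674,1603153,2651729,72626707,1389073,2437649,1673041,414770,5447939,5517843,274946,22225155,9982211,344321,1389057,2437633,8873219,8729107,1594417,8873235,410402,73740819,73745171,7680531,1528881,344865,8868371,9991443,2721633,2717265,1668689,9991763,6631955,1673057,41308947,73740547,42357523,5727009,1532977,6775585,88285443,1598513,6841121,475650,8681571107,13503940,23465412,30019012,100964240837,126734044613,25795445539,11109971,689986,694338,541186,137449993811,27960833059,11096323,8650187555,43406099]),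
([1280,2102], [48,768,2721633,16,414770,484674,5517843,5447939,6631955,1603153,1668689,2717265,7680531,270594,410402,1673041,9777683,0,8630055443,484386,1532977,41309235,8599926323,31723396]),
([1014,1569,1521,1836,2102], [784,64,768,414770,5517843,410402,414754,1603153,1673041,2651729,39072275,8630055443,8868627,9982739,484386,1532977,41309235,25650483,15994756]),
([1569,1521,1836,2102], [800,80,784,414770,5517843,410402,2507537,1454609,414754,1603153,1673041,2651729,9991763,16,5657377,0,270594,410130,1253633,2302209,90522403,7210948,14419908,27002820,15992772,66588248005,8868915,9983027,25650499,484370,475666,2238005779,8681571107,72556803,25650483,9982723]),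
([1568,1836,2102], [96,816,800,414770,5517843,410402,1533233,8873267,9991731,31727236]),
([1836,2102], [832,112,48,2721633,1673057,9991763,1603153,2651729,816,1668689,2717265,1673041,414770,5517843,410402,0,5657377,6705953,16,6705937,107299603,90518035,8868627,9991443,9987347,1528881,41308947,73745171,1532977,484386,90522403,7210948,20711364,66603976645,8681571107,554018,8616703555,43406387,9777411,2302209,88285443,475650]),
([1569,1837], [484674,484658,1463345]),
([2100,2364,507,1304,1520,2102], [864,144,5517843,270594,274946,16,0,1673057,484674,2511921,9986835,1598769,1598513,2721633,9921299,1532977,3551761,414481,6636307,7750417,9991699,80,1856,480290,1904,475938,1393169,2441745,39072275,9851667,6631683,74863379,26768979,88285443,6771489,17271440163,25810973203,6162372,13503428,12323780,14420932,28576708,126734044101,23413539,75912243,23273731,9843219,43541811,17222292531,541186,25862554403,17222292243,43541779,11100419,1742945,94996051,689986,1738577]),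
([2101,507,1304,1520,2102], [160,880,5517843,270594,32,16,1673057,484674,2511921,9986835,1598769,3551761,414481,6636307,7750417,9991699,2721633,9921299,554306,1528881,2577457,74863667,74863379,14421892,31723396,39072275,344578,545826,88285443,17255846963,9842947,26768947]),
([507,1304,2102,1520], [896,0,1673041,16]),
([1304,1520,2102], [192,912,64,48,484674,128,2721633,1673057,5517843,6636307,2511921,9921299,1532977,0,2302209,6496515,1792,9842947,6775585,344594,23413539,6162372,30672836,17204331299,554306,1952,17189860659,17271440163]),
([1540,2100,1305,2102], [208,928,344866,144,4399363,340482,2372097,1323521,21176579,80,484674,6566419,480034,2721633,1673057,9987075,9921539,5792817,1648]),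
([1833,2100,1520,2102], [944,224,160,16,344866,4399363,4539169,336130,96,80,340482,21176579,0,1458433,40190739,73675011,4384301315,479746,2576913,1602849,1602065,1528337,2651425,73675283,480306,1602881,1673025,2651457,484674,6566419,2372113,1323537,7824433,21516071443,4386607907,11931332,59204627,4387656483,9978115,42353427]),
([2100,1520,2102], [240,960,112,484674,32,344866,6566419,2372113,1323537,480306,96,1602881,0,5727281,41304851,9991187]),
([1832,1520,2102], [256,976,128,484674,48,344866,6566419,2372113,1323537,480306,112,5727281,41304851,1603137,9991187]),
([1834,2098,1520,2102], [992,272,64,16,800,1673025,3769665,2721601,0,208,344866,4399363,4539169,336130,144,554274,484674,6566419,7824433,21516071443,554577,340482,2372097,1323521,21176579,2372113,1323537,480034,480306,128,414481,3551761,2721633,1673057,2651713,9991747,7749891,2717249,9921539,73675283,40190739,73675011,6775585,4386607907,4384301315,14028484,125659778757,129954746053,545282,11109955,21567591203,690002,4337394451,78219075,26764307,11092227]),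
([2098,1520,2102], [1008,288,16,224,80,344866,4399363,4539169,336130,160,32,554274,484674,6566419,7824433,21516071443,554577,545570,340482,21176579,2372113,1323537,480034,480306,144,414481,3551761,2721633,1673057,0,91640883,108413715,8133316,15470468,23859076,30674820,9987091,9847043,2507009,9986307,59204659,60253235,42427411,21518382387,17254593043,623906,21567591203]),
([1520,2102], [304,176,484674,240,96,344866,480034,6566419,48,554577,545570,32,7824433,0,1603137,91640883,17272624179,14421892]),
([1547,2102], [320,0,192,484674,256,2511921,344866,4539169,4399363,484642,336130,4335153683]),
([1833,1303,2102], [1056,336,208,272,484642,16,0,2507537,484674,6566419,344866,344594,1936,336130,2187674131,344578,88285443,274946,23413523,480290,192,1673057,1532977,91636499,74863667,19368591891,14421892,554274,479746,17188738099,2236883203,9986819,40120579]),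
([1303,2102], [352,1072,224,484674,16,6566419,344866,32,2507537,208,288,344594,484642,480290,1952,23413523,40120851,1528881,2577457,336130,2187674131,0,1603121,9991731,1968,9990931,31723332,24527635,2239124515]),
([2102], [368,1088,1673057,304,240,484674,224,48,2511633,1454609,32,6566419,2507537,344866,0,1463329,2511905,39072275,23413539,270594,6162372,8128452,15468484,15992772,31721412,1253633,2302209,8873011,2304,554306,2128,480274,17271440163,2170896915,42427699,73605379,9986819]),
([1837], [0,554578]),
([1762,748,1303,1570,1039,1546], [0,400,1120,16,2581825,344866,7754803,14421892,8868915,1528881,1533249,1532977,2581553,31723396,12324740,414769,9908483,9990931,34368541747,624210,545826,43546163,34435650611]),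
([1570,1037,1546,1523], [16,416,32,1136,2507553,344866,400,7754803,1533249,2581825,8128452,12324740,22810500,30150532,63180676,2581553,1532977,1528881,23413539,9917491,9991219,344594,2016,344578,336130,88285443,0,24527635,2187674131,550178,34368541747,75982147,11110195,66588249989,2336,43546195]),
([749,1545,1571,1037,1039], [432,2302209,88285443,410114]),
([1014,1546,1521], [64,48,1168,448,1454609,2507537,16,554562,1532977,2581553,2507553,414754,550210,344866,39072275,7754515,8630055443,549922,2647089,0,7680259,41309235,14421892,15470468,30674820,109532211,8665916467,1673041,2721617,26768691,3769937,9777411]),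
([1811,1281,1544,1834,1546], [1532961,58086179,41309235,8130244]),
([1809,2076,1810,1281,1544,1834,1304], [80,1200,2647073,2188792867,14290756,30674756,2257015843,9991475]),
([1568,1567,1810,1544,506,1015,1832,1788,1302,1571,1304,1037], [496,112,96,1216,7545091,5447939,2302209,1253633,414738,550210,554562,2647345,7754499,72556803,2238005779,549906,409858,2186551555,0,41234947,9990915,554289,75982131,15997636,15996740,92754723,36549579811]),
([1543,2101,1808,3406,3518,1810,1281,1544,506,1015,1832,1788,1302,1571,1037], [512,128,112,1232,7545091,2302209,1253633,414738,550210,549906,409858,36549579811,2186551555,92754723,41234947,9990915]),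
([2635,2027,2319,6406,6566,6182,2077,1276,2099,2055,1810,748,770,1015,1571,1304,1037], [1248,144,128,550210,624194,2721361,9917187,1668689,690018,689730,689170,1738321,43044668995,94996307,44660307,10965763]),
([1567,1810,1544,506,1015,1832,1788,1302,1571,1304,1037,1523], [544,160,1264,144,7545091,2302209,7680259,5447939,1253633,550210,554562,32,90522403,107295251,6162372,11929540,14026692,22415300,7997380,12191684,20580292,30672836,24462115,2188792867,9991475,6845761,5797185,16,2238005779,72556803,41234963,9917187,9908483,9990931,92754723,36549579811,624194,1672785,2721361,43546195,43545907,93803299,118144108485,126734043077,131029010373,66633336773,34418873123,36550628387,45189841427,0,1742961,2791537,34370848339,10965763]),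
([1546,1521], [176,160,1280,560,1454609,2507553,2507537,344866,128,554562,550210,414754,2581553,1532977,96,270594,410130,5447939,2581537,1532961,80,7545091,0,2581793,2647329,24531747,14028484,29757124,15863492,30150340,30674628,31723204,92754723,2223465763,1673009,2721585,26768435,26768691,26768947,26768163,9642243]),
([1571,1547], [576,414770,410402,5517843]),
([1521], [192,208,1312,592,1454609,16,4604689,4604705,0,1533249,2581825,2511921,2511889,2511905,344866,72626707,4399363,7614995,414498,336130,24532019,1533233,2581809,4335153683,27004804,28053380,30150532,15994756,550178,4370949427,1598785,2647361,1598769,2647345,1673009,5796913,26768435,8663571,5866545,60322867,60314675,60318771,9712147]),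
([1499], [0,608,3551761]),
([1547], [224,16,1344,624,240,6701841,32,3420689,6636307,1533249,2581825,7754771,344866,7684627,72626707,4399363,7614995,414498,340482,24532019,1533233,21176579,8132292,15470468,23859076,15994756,28577668,41304851,7749891,9991187,9912579,73675283,1602881,5796913,92759091,1668673,4370949427,38747394851,624210,545570,623906,93807667,38698247475]),
([1543], [0,32,410385]),
([1570], [256,656,16,1533249,414769,1532977,7750419,7746067,224]),
([1305], [0,414770]),
([1835], [16,304,554562]),
([2079], [32,320,550210]),
([1301], [48,112,720,107299603]),
([1038], [48,736,5517843]),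
([1789], [48,112,2581553]),
([1833], [64,128,1532977]),
([1829], [80,128,1532945]),
([1785], [96,144,2581521]),
([1303], [64,144,414754]),
([1763], [48,224,2581265]),
([1807], [64,208,848,240,41308947]),
([1741], [64,240,3629585]),
([1545,1810,1014], [208,128,880,240,48,144,160,480,192,16,0,64,32,1600,80,39072275,7680259,2302209,274946,3490321,432,410114,73745171,575943171,75982099,24457475,9990403]),
([1036,1810,1014], [144,256,96,32,80,16,160,64,1616,48,128,112,496,896,176,208,224,512,9990931,39072275,7754515,7680531,0,90522403,14419908,75977779,30672836,12191684,14026692,11929540,7680259,2302209,274946,9917203,1668689,1602609,6705953,5657377,3490321,9991443,73745171,7684883,75982099,7753987,9990403,11110163,2441473,22294787,24322307,24457475,2816,690018,92754723,575943171,644166147,1672785,2721361,43546195,36549579811,118144108485,131029010373,66596636613,66633336773,689730,93807939,1738321,94996307,11105043,10965779,43545907,44660307,34418873123,43044668995,45726712323,689154]),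
([2092,1497,1810,1014], [176,160,112,48,96,32,80,1632,64,144,128,512,912,192,224,240,528,39072275,7680259,0,6566145,5517569,88285443,9990931,7754515,7680531,16,90522403,14419908,75977779,30672836,12191684,14026692,11929540,6162372,2302209,274946,9917203,1668689,1602609,6705953,5657377,3490321,9991443,9990403,11110163,24322307,2832,690018,24462115,92754723,1672785,2721361,43546195,36549579811,118144108485,131029010373,66596636613,66633336773,689730,93807939,1738321,94996307,11105043,10965779,43545907,44660307,34418873123,43044668995,45726712323,689154]),
([2635,2319,6406,6566,6182,2025,2077,991,1035,1013,2055,1810,1278], [80,144,160,1648,544,256,208,528,240,928,624194,2721361,9917203,1668689,9990931,1602609,690018,689730,689154,1738321,43044668995,94996307,44660307,10965779]),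
([2634,6438,2366,1810,1278], [1664,224,544,256,944,1742961,2791537,34370848339,10965779]),
([1497,1810,1014], [224,96,1680,112,208,320,576,288,240,272,560,128,176,192,960,39072275,7680259,48,6566145,5517569,88285443,9990931,7754515,7680531,64,90522403,14419908,75977779,55838660,28575684,12322756,11929540,11405252,6162372,2302209,1602609,6705953,5657377,9917203,3490321,9991443,32,75977491,34418873123,34402096179,45726712323,624194,541186,1672785,2721361,43546195,43042358051,118144108485,126734043077,131029010373,66596636613,66633336773,34386502963,0,690018,689730,16,1738321,34437957203,93807939,94996307,44660019,24462115,10957331]),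
([1810,1014], [144,192,208,576,288,224,368,336,976,240,592,304,1696,176,112,160,128,96,256,3490321,39072275,9991443,7754515,7680531,9990931,7680259,9917203,6705953,1602609,2302209,274946,80,90522403,11405252,12322756,14419908,75977779,64,88285443,0,644166147,24457475,9990403,75977491,34402096179,624194,541186,1672785,43546195,43042358051,126734043077,131029010373,34402095891,16,43545875,689730,11104515,1738321,94996307]),
([1014], [160,288,320,304,1712,128,256,992,592,352,608,240,3490321,39072275,7754515,9991443,0,1528881,41309235,6845745,6845761,5797185,8128452,8132036,12324740,28053380,15994756,24383364,34402096179,92759347,624194,549922,541474,90522403,5447939,274946,22225155,7753987,9916675,73740819,1668689,93807923,43042358051,42993214515,623650]),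
([507], [0,256,270594]),
([1545], [16,352,272,410130]),
([749], [16,1040,2302209]),
([1280], [32,368,1056,5447939]),
([1568], [16,464,288,432,1072,7745795]),
([1811], [16,48,384,448,608]),
([1279], [16,496,6705937]),
([], [16,0,1120,64,432,720,7680259])]

set_option maxRecDepth 100000 in
theorem cert_ok : check cert [] = true := by
  decide +kernel


/-! ## Soundness of the checker -/

def val (X : ℕ → ℕ → ℕ → Bool) (H : ℕ → Prop) (v : ℕ) : Prop :=
  if v < 1331 then X (v % 11) (v / 11 % 11) (v / 121) = true else H (v - 1331)

def satL (X : ℕ → ℕ → ℕ → Bool) (H : ℕ → Prop) (l : ℕ) : Prop :=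
  if l % 2 = 0 then val X H (l / 2) else ¬ val X H (l / 2)

def satC (X : ℕ → ℕ → ℕ → Bool) (H : ℕ → Prop) (c : List ℕ) : Prop := ∃ l ∈ c, satL X H l

theorem frc_eq {α : Type} (n : ℕ) (k : ℕ → α) : frc n k = k n := by
  cases n <;> rfl

theorem cnd_true {α : Type} (x y : α) : cnd true x y = x := rfl
theorem cnd_false {α : Type} (x y : α) : cnd false x y = y := rfl

theorem tb_eq (F l : ℕ) : tb F l = F.testBit l := by
  have h : tb F l = decide ((F >>> l) &&& 1 = 1) := by
    show Nat.beq ((F >>> l) &&& 1) 1 = _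
    rw [Bool.eq_iff_iff, Nat.beq_eq, decide_eq_true_iff]
  rw [h, Nat.testBit, Nat.and_comm 1]
  have h2 := Nat.and_one_is_mod (F >>> l)
  rcases Nat.mod_two_eq_zero_or_one (F >>> l) with h3 | h3 <;> simp [h2, h3]

theorem blt_iff (a b : ℕ) : blt a b = true ↔ a < b := by
  show Nat.ble (a + 1) b = true ↔ a < b
  rw [Nat.ble_eq]; omega

theorem satL_neg {X H} (l : ℕ) : satL X H (lneg l) ↔ ¬ satL X H l := by
  have h1 : lneg l / 2 = l / 2 := by
    show (l ^^^ 1) / 2 = l / 2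
    rw [Nat.xor_div_two]; simp
  have h2 : lneg l % 2 = (l + 1) % 2 := by
    show (l ^^^ 1) % 2 = _
    rw [Nat.xor_mod_two_eq]
  unfold satL
  rw [h1, h2]
  by_cases h : l % 2 = 0
  · rw [if_neg (by omega), if_pos h]
  · rw [if_pos (by omega), if_neg h, not_not]

theorem scan_sound {X H} (F : ℕ) (hF : ∀ l, F.testBit l = true → ¬ satL X H l) (c : List ℕ)
    (hc : satC X H c) : scan F c ≠ 0 ∧ (scan F c ≠ 1 → satL X H (scan F c - 2)) := by
  induction c with
  | nil => obtain ⟨l, hl, _⟩ := hc; simp at hl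
  | cons l ls ih =>
    have e : scan F (l :: ls) = cnd (tb F l) (scan F ls) (cnd (allF F ls) (l + 2) 1) :=
      frc_eq l (fun l => cnd (tb F l) (scan F ls) (cnd (allF F ls) (Nat.succ (Nat.succ l)) 1))
    rw [e, tb_eq]
    by_cases h : F.testBit l = true
    · rw [h, cnd_true]
      apply ih
      obtain ⟨k, hk, hs⟩ := hc
      rcases List.mem_cons.1 hk with rfl | hk
      · exact absurd hs (hF _ h)
      · exact ⟨k, hk, hs⟩
    · rw [Bool.not_eq_true] at h
      rw [h, cnd_false]
      have ha : ∀ ls : List ℕ, allF F ls = true → ∀ k ∈ ls, F.testBit k = true := by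
        intro ls
        induction ls with
        | nil => intro _ k hk; simp at hk
        | cons y ys ihy =>
          intro h k hk
          have e : allF F (y :: ys) = cnd (tb F y) (allF F ys) false := rfl
          rw [e, tb_eq] at h
          cases hy : F.testBit y
          · rw [hy, cnd_false] at h; cases h
          · rw [hy, cnd_true] at h
            rcases List.mem_cons.1 hk with rfl | hk
            · exact hy
            · exact ihy h k hk
      cases hl : allF F ls
      · rw [cnd_false]; simp
      · rw [cnd_true]
        refine ⟨by omega, fun _ => ?_⟩
        obtain ⟨k, hk, hs⟩ := hc
        rcases List.mem_cons.1 hk with rfl | hk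
        · simpa using hs
        · exact absurd hs (hF _ (ha ls hl k hk))

theorem satC_taut {X H} : satC X H tautC := by
  by_cases h : satL X H 0
  · exact ⟨0, by simp [tautC], h⟩
  · exact ⟨1, by simp [tautC], (satL_neg 0).2 h⟩

theorem nthC_sound {X H} (db : List (List ℕ)) (hdb : ∀ c ∈ db, satC X H c) (n : ℕ) :
    satC X H (nthC db n) := by
  induction db generalizing n with
  | nil => exact satC_taut
  | cons c cs ih =>
    cases n with
    | zero => exact hdb c (by simp)
    | succ n => exact ih (fun c hc => hdb c (by simp [hc])) n

theorem getC_sound {X H} (ho : ∀ f r, satC X H (orig f r)) (db : List (List ℕ))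
    (hdb : ∀ c ∈ db, satC X H c) (h : ℕ) : satC X H (getC db h) := by
  unfold getC
  rw [frc_eq, frc_eq]
  cases Nat.beq (Nat.mod h 16) 0
  · exact ho _ _
  · exact nthC_sound db hdb _

theorem setL_sound {X H} (F : ℕ) (hF : ∀ l, F.testBit l = true → ¬ satL X H l) (l : ℕ)
    (hl : ¬ satL X H l) : ∀ k, (setL F l).testBit k = true → ¬ satL X H k := by
  intro k hk
  have e : setL F l = F ||| 2 ^ l := rfl
  rw [e, Nat.testBit_or, Bool.or_eq_true, Nat.testBit_two_pow] at hk
  rcases hk with hk | hk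
  · exact hF k hk
  · have : l = k := by simpa using hk
    rwa [← this]

theorem rup_sound {X H} (ho : ∀ f r, satC X H (orig f r)) (db : List (List ℕ))
    (hdb : ∀ c ∈ db, satC X H c) (hs : List ℕ) (F : ℕ)
    (hF : ∀ l, F.testBit l = true → ¬ satL X H l) : rup db hs F = false := by
  induction hs generalizing F with
  | nil => rfl
  | cons h hs ih =>
    have e : rup db (h :: hs) F = cnd (Nat.beq (scan F (getC db h)) 0) true
        (cnd (Nat.beq (scan F (getC db h)) 1) false
          (rup db hs (setL F (lneg (scan F (getC db h) - 2))))) := by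
      refine (frc_eq (scan F (getC db h)) (fun r => cnd (Nat.beq r 0) true
        (cnd (Nat.beq r 1) false (frc (setL F (lneg (Nat.sub r 2))) (rup db hs))))).trans ?_
      simp only [frc_eq]; rfl
    rw [e]
    obtain ⟨h0, h1⟩ := scan_sound F hF _ (getC_sound ho db hdb h)
    have b0 : Nat.beq (scan F (getC db h)) 0 = false := by
      rw [← Bool.not_eq_true, Nat.beq_eq]; exact h0
    rw [b0, cnd_false]
    by_cases b : scan F (getC db h) = 1
    · rw [b]; rfl
    · have b1 : Nat.beq (scan F (getC db h)) 1 = false := by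
        rw [← Bool.not_eq_true, Nat.beq_eq]; exact b
      rw [b1, cnd_false]
      apply ih
      apply setL_sound F hF
      rw [satL_neg, not_not]
      exact h1 b

theorem maskOf_sound {X H} (c : List ℕ) (hc : ¬ satC X H c) :
    ∀ k, (maskOf c).testBit k = true → ¬ satL X H k := by
  induction c with
  | nil =>
    intro k hk
    have : maskOf [] = 0 := rfl
    simp [this] at hk
  | cons l ls ih =>
    have e : maskOf (l :: ls) = setL (maskOf ls) l := rfl
    rw [e]
    apply setL_sound
    · apply ih
      rintro ⟨k, hk, h⟩
      exact hc ⟨k, by simp [hk], h⟩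
    · intro h
      exact hc ⟨l, by simp, h⟩

theorem check_sound {X H} (ho : ∀ f r, satC X H (orig f r)) (ss : List (List ℕ × List ℕ))
    (db : List (List ℕ)) (hdb : ∀ c ∈ db, satC X H c) : check ss db = false := by
  induction ss generalizing db with
  | nil => rfl
  | cons s ss ih =>
    have e : check (s :: ss) db = cnd (rup db s.2 (maskOf s.1))
        (cnd s.1.isEmpty true (check ss (s.1 :: db))) false := by
      show cnd (frc _ _) _ _ = _
      rw [frc_eq]; rfl
    rw [e]
    cases hr : rup db s.2 (maskOf s.1) with
    | false => rfl
    | true =>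
      have hs : satC X H s.1 := by
        by_contra hs
        rw [rup_sound ho db hdb _ _ (maskOf_sound _ hs)] at hr
        cases hr
      rw [cnd_true]
      cases he : s.1.isEmpty with
      | true =>
        rw [List.isEmpty_iff] at he
        rw [he] at hs
        obtain ⟨l, hl, _⟩ := hs
        simp at hl
      | false =>
        rw [cnd_false]
        apply ih
        intro c hc
        rcases List.mem_cons.1 hc with rfl | hc
        · exact hs
        · exact hdb c hc


/-! ## The combinatorial core -/

/-- at most one sign change -/
def sg (z0 z1 z2 z3 : Bool) : Bool :=
  !(xor z0 z1 && xor z1 z2) && !(xor z0 z1 && xor z1 z3) && !(xor z0 z2 && xor z2 z3) &&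
    !(xor z1 z2 && xor z2 z3)

/-- five points (ordered) in convex position, the middle ones of the given types -/
structure Cvx (X : ℕ → ℕ → ℕ → Bool) (a b c d e : ℕ) (t1 t2 t3 : Bool) : Prop where
  abc : X a b c = t1
  abd : X a b d = t1
  abe : X a b e = t1
  acd : X a c d = t2
  ace : X a c e = t2
  bcd : X b c d = t2
  bce : X b c e = t2
  ade : X a d e = t3
  bde : X b d e = t3
  cde : X c d e = t3

theorem satL_litX {X H} {a b c : ℕ} (ha : a < 11) (hb : b < 11) (hc : c < 11) :
    satL X H (litX a b c) ↔ X a b c = true := by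
  have e : litX a b c = 2 * (a + (11 * b + 121 * c)) := rfl
  have h1 : 2 * (a + (11 * b + 121 * c)) / 2 = a + (11 * b + 121 * c) := by omega
  have h2 : (a + (11 * b + 121 * c)) % 11 = a := by omega
  have h3 : (a + (11 * b + 121 * c)) / 11 % 11 = b := by omega
  have h4 : (a + (11 * b + 121 * c)) / 121 = c := by omega
  unfold satL val
  rw [e, h1, if_pos (by omega), if_pos (by omega), h2, h3, h4]

theorem satL_succ {X H} {l : ℕ} (h : l % 2 = 0) : satL X H (Nat.succ l) ↔ ¬ satL X H l := by
  have h1 : Nat.succ l / 2 = l / 2 := by simp only [Nat.succ_eq_add_one]; omega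
  unfold satL
  rw [h1, if_neg (by simp only [Nat.succ_eq_add_one]; omega), if_pos h]

theorem satL_litN {X H} (s : Bool) {a b c : ℕ} (ha : a < 11) (hb : b < 11) (hc : c < 11) :
    satL X H (litN s a b c) ↔ X a b c ≠ s := by
  cases s
  · have : litN false a b c = litX a b c := rfl
    rw [this, satL_litX ha hb hc]; simp
  · have : litN true a b c = Nat.succ (litX a b c) := rfl
    rw [this, satL_succ (l := litX a b c) (Nat.mul_mod_right 2 _), satL_litX ha hb hc]

theorem satL_litH {X H} (n : ℕ) : satL X H (litH n) ↔ H n := by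
  have e : litH n = 2 * (1331 + n) := rfl
  have h1 : 2 * (1331 + n) / 2 = 1331 + n := by omega
  have h2 : 1331 + n - 1331 = n := by omega
  unfold satL val
  rw [e, h1, if_pos (by omega), if_neg (by omega), h2]

theorem satL_litHn {X H} (n : ℕ) : satL X H (Nat.succ (litH n)) ↔ ¬ H n := by
  rw [satL_succ (l := litH n) (Nat.mul_mod_right 2 _), satL_litH]

theorem mem_gapX (u v : ℕ) (tl ks : List ℕ) (l : ℕ) :
    l ∈ gapX u v tl ks ↔ (∃ k ∈ ks, u < k ∧ k < v ∧ l = litN true u k v) ∨ l ∈ tl := by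
  induction ks with
  | nil => simp [gapX]
  | cons k ks ih =>
    have e : gapX u v tl (k :: ks) = cnd (blt u k) (cnd (blt k v)
      (litN true u k v :: gapX u v tl ks) (gapX u v tl ks)) (gapX u v tl ks) := rfl
    have h1 := blt_iff u k
    have h2 := blt_iff k v
    rw [e]
    cases hb1 : blt u k <;> cases hb2 : blt k v <;> rw [hb1] at h1 <;> rw [hb2] at h2 <;>
      simp only [cnd_true, cnd_false, List.mem_cons, ih] <;> simp at h1 h2 <;> grind

theorem mem_idx (x : ℕ) : x ∈ idx ↔ x < 11 := by
  unfold idx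
  simp only [List.mem_cons, List.not_mem_nil, or_false]
  omega

theorem between_iff (a b c d e x : ℕ) : between a b c d e x = true ↔
    a < x ∧ x < e ∧ x ≠ b ∧ x ≠ c ∧ x ≠ d := by
  unfold between
  have h1 := blt_iff a x
  have h2 := blt_iff x e
  have h3 : Nat.beq x b = true ↔ x = b := by rw [Nat.beq_eq]
  have h4 : Nat.beq x c = true ↔ x = c := by rw [Nat.beq_eq]
  have h5 : Nat.beq x d = true ↔ x = d := by rw [Nat.beq_eq]
  cases hb1 : blt a x <;> cases hb2 : blt x e <;> cases hb3 : Nat.beq x b <;>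
    cases hb4 : Nat.beq x c <;> cases hb5 : Nat.beq x d <;>
    simp_all [cnd_true, cnd_false]

theorem mem_outX (a b c d e : ℕ) (t1 t2 t3 : Bool) (ch : ℕ) (xs : List ℕ) (x : ℕ) (hx : x ∈ xs)
    (hb : between a b c d e x = true) :
    ∃ s, litN s (edgeL a b c d t1 t2 t3 s x) x (edgeR b c d e t1 t2 t3 s x) ∈
      outX a b c d e t1 t2 t3 ch xs := by
  induction xs with
  | nil => simp at hx
  | cons y ys ih =>
    have e' : outX a b c d e t1 t2 t3 ch (y :: ys) = cnd (between a b c d e y)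
      (cnd (tb ch y)
        (litN true (edgeL a b c d t1 t2 t3 true y) y (edgeR b c d e t1 t2 t3 true y) ::
          outX a b c d e t1 t2 t3 ch ys)
        (litN false (edgeL a b c d t1 t2 t3 false y) y (edgeR b c d e t1 t2 t3 false y) ::
          outX a b c d e t1 t2 t3 ch ys))
      (outX a b c d e t1 t2 t3 ch ys) := rfl
    rw [e']
    rcases List.mem_cons.1 hx with rfl | hx
    · rw [hb, cnd_true]
      cases tb ch x
      · exact ⟨false, by rw [cnd_false]; simp⟩
      · exact ⟨true, by rw [cnd_true]; simp⟩
    · obtain ⟨s, hs⟩ := ih hx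
      refine ⟨s, ?_⟩
      cases between a b c d e y <;> cases tb ch y <;> simp [cnd_true, cnd_false, hs]

theorem ord4_iff (a b c d : ℕ) : ord4 a b c d = true ↔ a < b ∧ b < c ∧ c < d ∧ d < 11 := by
  unfold ord4
  have h1 := blt_iff a b
  have h2 := blt_iff b c
  have h3 := blt_iff c d
  have h4 := blt_iff d 11
  cases hb1 : blt a b <;> cases hb2 : blt b c <;> cases hb3 : blt c d <;>
    simp_all [cnd_true, cnd_false]

theorem mem_hyps_tl (a b c d e : ℕ) (t1 t2 t3 : Bool) (tl : List ℕ) (l : ℕ) (h : l ∈ tl) :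
    l ∈ hyps a b c d e t1 t2 t3 tl := by
  cases t1 <;> cases t2 <;> cases t3 <;> simp [hyps, cnd_true, cnd_false, h]

def bool_h (abc abd abe acd ace ade bcd bce bde cde t1 t2 t3 : Bool) : Bool :=
  cnd t1
    (cnd t2 (cnd t3 (abc && bcd && cde) (abc && bce && !ade))
      (cnd t3 (abd && bde && !ace) (abe && !acd && !cde)))
    (cnd t2 (cnd t3 (acd && cde && !abe) (ace && !abd && !bde))
      (cnd t3 (ade && !abc && !bce) (!abc && !bcd && !cde)))

theorem bool_cvx : ∀ abc abd abe acd ace ade bcd bce bde cde : Bool,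
    sg abc abd acd bcd = true → sg abc abe ace bce = true → sg abd abe ade bde = true →
    sg acd ace ade cde = true → sg bcd bce bde cde = true →
    ∀ t1 t2 t3 : Bool,
    (match t1, t2, t3 with
      | true, true, true => abc = true ∧ bcd = true ∧ cde = true
      | true, true, false => abc = true ∧ bce = true ∧ ade = false
      | true, false, true => abd = true ∧ bde = true ∧ ace = false
      | true, false, false => abe = true ∧ acd = false ∧ cde = false
      | false, true, true => acd = true ∧ cde = true ∧ abe = false
      | false, true, false => ace = true ∧ abd = false ∧ bde = false
      | false, false, true => ade = true ∧ abc = false ∧ bce = false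
      | false, false, false => abc = false ∧ bcd = false ∧ cde = false) →
    (abc = t1 ∧ abd = t1 ∧ abe = t1 ∧ acd = t2 ∧ ace = t2 ∧ bcd = t2 ∧ bce = t2 ∧
      ade = t3 ∧ bde = t3 ∧ cde = t3) := by
  intro abc abd abe acd ace ade bcd bce bde cde h1 h2 h3 h4 h5 t1 t2 t3 h
  have key : ∀ abc abd abe acd ace ade bcd bce bde cde t1 t2 t3 : Bool,
      (!(sg abc abd acd bcd && sg abc abe ace bce && sg abd abe ade bde && sg acd ace ade cde &&
        sg bcd bce bde cde && bool_h abc abd abe acd ace ade bcd bce bde cde t1 t2 t3) ||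
        (abc == t1 && abd == t1 && abe == t1 && acd == t2 && ace == t2 && bcd == t2 && bce == t2 &&
          ade == t3 && bde == t3 && cde == t3)) = true := by decide +kernel
  have := key abc abd abe acd ace ade bcd bce bde cde t1 t2 t3
  have hb : bool_h abc abd abe acd ace ade bcd bce bde cde t1 t2 t3 = true := by
    cases t1 <;> cases t2 <;> cases t3 <;> simp only at h <;> simp only [bool_h, h] <;> rfl
  rw [h1, h2, h3, h4, h5, hb] at this
  simp only [Bool.and_true, Bool.not_true, Bool.false_or, Bool.and_eq_true, beq_iff_eq] at this
  tauto

theorem edge_lt {a b c d e : ℕ} (h1 : a < b) (h2 : b < c) (h3 : c < d) (h4 : d < e)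
    (h5 : e < 11) (t1 t2 t3 s : Bool) (x : ℕ) :
    edgeL a b c d t1 t2 t3 s x < 11 ∧ edgeR b c d e t1 t2 t3 s x < 11 := by
  unfold edgeL edgeR
  constructor
  · generalize (cnd (blt d x) (beqB t3 s) false) = u
    generalize (cnd (blt c x) (beqB t2 s) false) = v
    generalize (cnd (blt b x) (beqB t1 s) false) = w
    cases u <;> cases v <;> cases w <;> simp only [cnd_true, cnd_false] <;> omega
  · generalize (cnd (blt x b) (beqB t1 s) false) = u
    generalize (cnd (blt x c) (beqB t2 s) false) = v
    generalize (cnd (blt x d) (beqB t3 s) false) = w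
    cases u <;> cases v <;> cases w <;> simp only [cnd_true, cnd_false] <;> omega

theorem core (X : ℕ → ℕ → ℕ → Bool) (H : ℕ → Prop)
    (hs : ∀ a b c d, a < b → b < c → c < d → d < 11 →
      sg (X a b c) (X a b d) (X a c d) (X b c d) = true)
    (hp : ∀ a b c d, a < b → b < c → c < d → d < 11 → X a b c = true → X b c d = true →
      (∀ k, a < k → k < b → X a k b = true) → (∀ k, b < k → k < c → X b k c = true) →
      (∀ k, c < k → k < d → X c k d = true) → False)
    (hh : ∀ a b c d e t1 t2 t3, a < b → b < c → c < d → d < e → e < 11 →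
      Cvx X a b c d e t1 t2 t3 →
      (∀ x, a < x → x < e → x ≠ b → x ≠ c → x ≠ d →
        ∃ s, X (edgeL a b c d t1 t2 t3 s x) x (edgeR b c d e t1 t2 t3 s x) = s) →
      H (sum5 a b c d e))
    (h1 : ∀ a b c d e, a < b → b < c → c < d → d < e → e < 11 → a < 2 → ¬ H (sum5 a b c d e))
    (h2 : ∀ m n, m ≠ n → m % 16 ≠ 0 → n % 16 ≠ 0 → m < 2048 → n < 2048 → H m → H n → False)
    (h3 : ∀ m n k, m ≠ n → m ≠ k → n ≠ k → m % 64 ≠ 0 → n % 64 ≠ 0 → k % 64 ≠ 0 →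
      m < 2048 → n < 2048 → k < 2048 → H m → H n → H k → False) : False := by
  have key : ∀ f r, satC X H (orig f r) := by
    intro f r
    unfold orig
    cases Nat.ble f 3 with
    | false =>
      rw [cnd_false]
      cases Nat.beq f 4 with
      | true =>
        rw [cnd_true, frc_eq, frc_eq]
        generalize Nat.mod r 2048 = m
        generalize Nat.div r 2048 = n
        unfold c2
        by_contra hc
        cases hb : (neB m n && ne0 (Nat.mod m 16) && ne0 (Nat.mod n 16) && blt m 2048
            && blt n 2048) with
        | false => rw [hb, cnd_false] at hc; exact hc satC_taut
        | true =>
          rw [hb, cnd_true] at hc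
          simp only [Bool.and_eq_true, blt_iff] at hb
          obtain ⟨⟨⟨⟨b1, b2⟩, b3⟩, b4⟩, b5⟩ := hb
          have hm : H m := by
            by_contra h; exact hc ⟨_, by simp, (satL_litHn m).2 h⟩
          have hn : H n := by
            by_contra h; exact hc ⟨Nat.succ (litH n), by simp, (satL_litHn n).2 h⟩
          refine h2 m n ?_ ?_ ?_ b4 b5 hm hn
          · rintro rfl; simp [neB, cnd] at b1
          · intro h; have : Nat.mod m 16 = 0 := h; simp [ne0, this, cnd] at b2
          · intro h; have : Nat.mod n 16 = 0 := h; simp [ne0, this, cnd] at b3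
      | false =>
        rw [cnd_false, frc_eq, frc_eq, frc_eq]
        generalize Nat.mod r 2048 = m
        generalize Nat.mod (Nat.div r 2048) 2048 = n
        generalize Nat.div r 4194304 = k
        unfold c3
        by_contra hc
        cases hb : (neB m n && neB m k && neB n k && ne0 (Nat.mod m 64) && ne0 (Nat.mod n 64)
            && ne0 (Nat.mod k 64) && blt m 2048 && blt n 2048 && blt k 2048) with
        | false => rw [hb, cnd_false] at hc; exact hc satC_taut
        | true =>
          rw [hb, cnd_true] at hc
          simp only [Bool.and_eq_true, blt_iff] at hb
          obtain ⟨⟨⟨⟨⟨⟨⟨⟨b1, b2⟩, b3⟩, b4⟩, b5⟩, b6⟩, b7⟩, b8⟩, b9⟩ := hb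
          have hm : H m := by
            by_contra h; exact hc ⟨_, by simp, (satL_litHn m).2 h⟩
          have hn : H n := by
            by_contra h; exact hc ⟨Nat.succ (litH n), by simp, (satL_litHn n).2 h⟩
          have hk : H k := by
            by_contra h; exact hc ⟨Nat.succ (litH k), by simp, (satL_litHn k).2 h⟩
          refine h3 m n k ?_ ?_ ?_ ?_ ?_ ?_ b7 b8 b9 hm hn hk
          · rintro rfl; simp [neB, cnd] at b1
          · rintro rfl; simp [neB, cnd] at b2
          · rintro rfl; simp [neB, cnd] at b3
          · intro h; have : Nat.mod m 64 = 0 := h; simp [ne0, this, cnd] at b4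
          · intro h; have : Nat.mod n 64 = 0 := h; simp [ne0, this, cnd] at b5
          · intro h; have : Nat.mod k 64 = 0 := h; simp [ne0, this, cnd] at b6
    | true =>
      rw [cnd_true]
      simp only [frc_eq]
      generalize dig r 0 = a
      generalize dig r 4 = b
      generalize dig r 8 = c
      generalize dig r 12 = d
      generalize dig r 16 = e
      cases ho : ord4 a b c d with
      | false => rw [cnd_false]; exact satC_taut
      | true =>
        rw [cnd_true]
        obtain ⟨hab, hbc, hcd, hd⟩ := (ord4_iff a b c d).1 ho
        have ha' : a < 11 := by omega
        have hb' : b < 11 := by omega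
        have hc' : c < 11 := by omega
        by_contra hC
        cases hf1 : Nat.beq f 1 with
        | true =>
          rw [hf1, cnd_true] at hC
          have S := hs a b c d hab hbc hcd hd
          unfold sClause at hC
          have L1 : ∀ s, satL X H (litN s a b c) ↔ X a b c ≠ s := fun s => satL_litN s ha' hb' hc'
          have L2 : ∀ s, satL X H (litN s a b d) ↔ X a b d ≠ s := fun s => satL_litN s ha' hb' hd
          have L3 : ∀ s, satL X H (litN s a c d) ↔ X a c d ≠ s := fun s => satL_litN s ha' hc' hd
          have L4 : ∀ s, satL X H (litN s b c d) ↔ X b c d ≠ s := fun s => satL_litN s hb' hc' hd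
          generalize Nat.beq e 0 = e0 at hC
          generalize Nat.beq e 1 = e1 at hC
          generalize Nat.beq e 2 = e2 at hC
          generalize Nat.beq e 3 = e3 at hC
          generalize Nat.beq e 4 = e4 at hC
          generalize Nat.beq e 5 = e5 at hC
          generalize Nat.beq e 6 = e6 at hC
          have fin : ∀ i j k : ℕ, ¬ satC X H [i, j, k] →
              ¬ satL X H i ∧ ¬ satL X H j ∧ ¬ satL X H k := by
            intro i j k h
            refine ⟨fun h' => h ⟨i, by simp, h'⟩, fun h' => h ⟨j, by simp, h'⟩,
              fun h' => h ⟨k, by simp, h'⟩⟩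
          cases e0 with
          | true =>
            have := fin _ _ _ hC
            simp only [L1, L2, L3, L4, not_not] at this
            obtain ⟨x1, x2, x3⟩ := this
            rw [x1, x2, x3] at S; simp [sg] at S
          | false =>
          cases e1 with
          | true =>
            have := fin _ _ _ hC
            simp only [L1, L2, L3, L4, not_not] at this
            obtain ⟨x1, x2, x3⟩ := this
            rw [x1, x2, x3] at S; simp [sg] at S
          | false =>
          cases e2 with
          | true =>
            have := fin _ _ _ hC
            simp only [L1, L2, L3, L4, not_not] at this
            obtain ⟨x1, x2, x3⟩ := this
            rw [x1, x2, x3] at S; simp [sg] at S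
          | false =>
          cases e3 with
          | true =>
            have := fin _ _ _ hC
            simp only [L1, L2, L3, L4, not_not] at this
            obtain ⟨x1, x2, x3⟩ := this
            rw [x1, x2, x3] at S; simp [sg] at S
          | false =>
          cases e4 with
          | true =>
            have := fin _ _ _ hC
            simp only [L1, L2, L3, L4, not_not] at this
            obtain ⟨x1, x2, x3⟩ := this
            rw [x1, x2, x3] at S; simp [sg] at S
          | false =>
          cases e5 with
          | true =>
            have := fin _ _ _ hC
            simp only [L1, L2, L3, L4, not_not] at this
            obtain ⟨x1, x2, x3⟩ := this
            rw [x1, x2, x3] at S; simp [sg] at S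
          | false =>
          cases e6 with
          | true =>
            have := fin _ _ _ hC
            simp only [L1, L2, L3, L4, not_not] at this
            obtain ⟨x1, x2, x3⟩ := this
            rw [x1, x2, x3] at S; simp [sg] at S
          | false =>
            have := fin _ _ _ hC
            simp only [L1, L2, L3, L4, not_not] at this
            obtain ⟨x1, x2, x3⟩ := this
            rw [x1, x2, x3] at S; simp [sg] at S
        | false =>
        rw [hf1, cnd_false] at hC
        cases hf2 : Nat.beq f 2 with
        | true =>
          rw [hf2, cnd_true] at hC
          have hall : ∀ l ∈ pClause a b c d, ¬ satL X H l := fun l hl h => hC ⟨l, hl, h⟩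
          unfold pClause at hall
          refine hp a b c d hab hbc hcd hd ?_ ?_ ?_ ?_ ?_
          · have := hall (litN true a b c) (by simp)
            rwa [satL_litN true ha' hb' hc', not_not] at this
          · have := hall (litN true b c d) (by simp)
            rwa [satL_litN true hb' hc' hd, not_not] at this
          · intro k k1 k2
            have := hall (litN true a k b) (by
              simp only [List.mem_cons, mem_gapX]
              exact Or.inr (Or.inr (Or.inl ⟨k, (mem_idx k).2 (by omega), k1, k2, rfl⟩)))
            rwa [satL_litN true ha' (by omega) hb', not_not] at this
          · intro k k1 k2
            have := hall (litN true b k c) (by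
              simp only [List.mem_cons, mem_gapX]
              exact Or.inr (Or.inr (Or.inr (Or.inl ⟨k, (mem_idx k).2 (by omega), k1, k2, rfl⟩))))
            rwa [satL_litN true hb' (by omega) hc', not_not] at this
          · intro k k1 k2
            have := hall (litN true c k d) (by
              simp only [List.mem_cons, mem_gapX]
              exact Or.inr (Or.inr (Or.inr (Or.inr
                (Or.inl ⟨k, (mem_idx k).2 (by omega), k1, k2, rfl⟩)))))
            rwa [satL_litN true hc' (by omega) hd, not_not] at this
        | false =>
        rw [hf2, cnd_false] at hC
        cases hde : blt d e with
        | false => rw [hde, cnd_false] at hC; exact hC satC_taut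
        | true =>
        cases he : blt e 11 with
        | false => rw [hde, cnd_true, he, cnd_false] at hC; exact hC satC_taut
        | true =>
        rw [hde, cnd_true, he, cnd_true] at hC
        rw [blt_iff] at hde he
        generalize tb r 20 = t1 at hC
        generalize tb r 21 = t2 at hC
        generalize tb r 22 = t3 at hC
        generalize Nat.shiftRight r 24 = ch at hC
        have hall : ∀ l ∈ hyps a b c d e t1 t2 t3 (outX a b c d e t1 t2 t3 ch idx),
            ¬ satL X H l := by
          intro l hl h
          refine hC ⟨l, ?_, h⟩
          unfold hClause
          cases blt a 2
          · rw [cnd_false]; simp [hl]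
          · rw [cnd_true]; exact hl
        have hnH : ¬ H (sum5 a b c d e) := by
          intro hH
          cases hb : blt a 2 with
          | true => exact h1 a b c d e hab hbc hcd hde he ((blt_iff _ _).1 hb) hH
          | false =>
            apply hC
            unfold hClause
            rw [hb, cnd_false]
            exact ⟨_, List.mem_cons_self, (satL_litH _).2 hH⟩
        apply hnH
        have lit : ∀ s i j k, i < 11 → j < 11 → k < 11 →
            litN s i j k ∈ hyps a b c d e t1 t2 t3 (outX a b c d e t1 t2 t3 ch idx) →
            X i j k = s := by
          intro s i j k hi hj hk hm
          have := hall _ hm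
          rwa [satL_litN s hi hj hk, not_not] at this
        refine hh a b c d e t1 t2 t3 hab hbc hcd hde he ?_ ?_
        · have B := bool_cvx _ _ _ _ _ _ _ _ _ _ (hs a b c d hab hbc hcd hd)
            (hs a b c e hab hbc (by omega) he) (hs a b d e hab (by omega) hde he)
            (hs a c d e (by omega) hcd hde he) (hs b c d e hbc hcd hde he) t1 t2 t3 (by
              cases t1 <;> cases t2 <;> cases t3 <;>
                refine ⟨lit _ _ _ _ ?_ ?_ ?_ ?_, lit _ _ _ _ ?_ ?_ ?_ ?_,
                  lit _ _ _ _ ?_ ?_ ?_ ?_⟩ <;>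
                first
                  | assumption
                  | simp [hyps, cnd_true, cnd_false])
          obtain ⟨b1, b2, b3, b4, b5, b6, b7, b8, b9, b10⟩ := B
          exact ⟨b1, b2, b3, b4, b5, b6, b7, b8, b9, b10⟩
        · intro x x1 x2 x3 x4 x5
          obtain ⟨s, hs'⟩ := mem_outX a b c d e t1 t2 t3 ch idx x ((mem_idx x).2 (by omega))
            ((between_iff _ _ _ _ _ _).2 ⟨x1, x2, x3, x4, x5⟩)
          obtain ⟨g1, g2⟩ := edge_lt hab hbc hcd hde he t1 t2 t3 s x
          exact ⟨s, lit s _ _ _ g1 (by omega) g2 (mem_hyps_tl _ _ _ _ _ _ _ _ _ _ hs')⟩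
  have := check_sound key cert [] (by simp)
  rw [cert_ok] at this
  cases this



/-! ## Geometry -/

/-- orientation determinant -/
def dt (a b c : Pt) : ℝ := (b.1 - a.1) * (c.2 - a.2) - (b.2 - a.2) * (c.1 - a.1)

theorem dt_cyc (a b c : Pt) : dt b c a = dt a b c := by unfold dt; ring
theorem dt_swap (a b c : Pt) : dt a c b = - dt a b c := by unfold dt; ring
theorem dt_swap' (a b c : Pt) : dt b a c = - dt a b c := by unfold dt; ring
theorem dt_self1 (a b : Pt) : dt a b b = 0 := by unfold dt; ring
theorem dt_self2 (a b : Pt) : dt a b a = 0 := by unfold dt; ring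
theorem dt_self3 (a b : Pt) : dt a a b = 0 := by unfold dt; ring

theorem lin_form (α β : ℝ) : IsLinearMap ℝ (fun z : Pt => α * z.1 + β * z.2) :=
  ⟨fun x y => by simp only [Prod.fst_add, Prod.snd_add]; ring,
    fun c x => by simp only [Prod.smul_fst, Prod.smul_snd, smul_eq_mul]; ring⟩

theorem nh_lin_pos (α β γ : ℝ) (T : Set Pt) (y : Pt) (h1 : ∀ z ∈ T, γ < α * z.1 + β * z.2)
    (h2 : α * y.1 + β * y.2 ≤ γ) : y ∉ convexHull ℝ T := by
  intro h
  have := convexHull_min (s := T) (t := {z : Pt | γ < α * z.1 + β * z.2}) h1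
    (convex_halfSpace_gt (lin_form α β) γ) h
  have : γ < α * y.1 + β * y.2 := this
  linarith

theorem nh_lin_nonneg (α β γ : ℝ) (T : Set Pt) (y : Pt) (h1 : ∀ z ∈ T, γ ≤ α * z.1 + β * z.2)
    (h2 : α * y.1 + β * y.2 < γ) : y ∉ convexHull ℝ T := by
  intro h
  have := convexHull_min (s := T) (t := {z : Pt | γ ≤ α * z.1 + β * z.2}) h1
    (convex_halfSpace_ge (lin_form α β) γ) h
  have : γ ≤ α * y.1 + β * y.2 := this
  linarith

theorem nh_pos (a b : Pt) (T : Set Pt) (y : Pt) (h1 : ∀ z ∈ T, 0 < dt a b z)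
    (h2 : dt a b y ≤ 0) : y ∉ convexHull ℝ T := by
  refine nh_lin_pos (-(b.2 - a.2)) (b.1 - a.1) ((b.1 - a.1) * a.2 - (b.2 - a.2) * a.1) T y ?_ ?_
  · intro z hz; have := h1 z hz; unfold dt at this; linarith
  · unfold dt at h2; linarith

theorem nh_nonneg (a b : Pt) (T : Set Pt) (y : Pt) (h1 : ∀ z ∈ T, 0 ≤ dt a b z)
    (h2 : dt a b y < 0) : y ∉ convexHull ℝ T := by
  refine nh_lin_nonneg (-(b.2 - a.2)) (b.1 - a.1) ((b.1 - a.1) * a.2 - (b.2 - a.2) * a.1) T y ?_ ?_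
  · intro z hz; have := h1 z hz; unfold dt at this; linarith
  · unfold dt at h2; linarith

theorem nh_sum (p a e : Pt) (T : Set Pt) (h1 : ∀ z ∈ T, 0 < dt p a z + dt p z e) :
    p ∉ convexHull ℝ T := by
  refine nh_lin_pos (-(a.2 - p.2) + (e.2 - p.2)) ((a.1 - p.1) - (e.1 - p.1))
    ((a.1 - p.1) * p.2 - (a.2 - p.2) * p.1 + (p.1 * (e.2 - p.2) - p.2 * (e.1 - p.1))) T p ?_ ?_
  · intro z hz; have := h1 z hz; unfold dt at this; linarith
  · apply le_of_eq; ring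

theorem hole_of (P S : Finset Pt) (h1 : S ⊆ P) (h2 : S.card = 5)
    (h3 : ∀ y ∈ P, y ∉ convexHull ℝ ((S : Set Pt) \ {y})) : IsHole 5 P S := by
  refine ⟨h1, h2, fun x hx => h3 x (h1 hx), fun x hx hc => ?_⟩
  by_contra hn
  apply h3 x hx
  rwa [Set.sdiff_singleton_eq_self (by simpa using hn)]

theorem dt_ne (P : Finset Pt) (hP : GenPos P) (a b c : Pt) (ha : a ∈ P) (hb : b ∈ P) (hc : c ∈ P)
    (hab : a ≠ b) (hac : a ≠ c) (hbc : b ≠ c) : dt a b c ≠ 0 := by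
  intro h
  refine hP {a, b, c} ?_ (Finset.card_eq_three.2 ⟨a, b, c, hab, hac, hbc, rfl⟩) ?_
  · intro z hz; simp only [Finset.mem_insert, Finset.mem_singleton] at hz
    rcases hz with rfl | rfl | rfl <;> assumption
  · rw [collinear_iff_of_mem (p₀ := a) (by simp)]
    refine ⟨b - a, ?_⟩
    intro z hz
    simp only [Finset.coe_insert, Finset.coe_singleton, Set.mem_insert_iff,
      Set.mem_singleton_iff] at hz
    rcases hz with rfl | rfl | rfl
    · exact ⟨0, by simp⟩
    · exact ⟨1, by simp⟩
    · unfold dt at h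
      by_cases h1 : b.1 - a.1 = 0
      · have h2 : b.2 - a.2 ≠ 0 := by
          intro h2; apply hab; ext <;> linarith
        refine ⟨(z.2 - a.2) / (b.2 - a.2), ?_⟩
        have h3 : z.1 - a.1 = 0 := by
          rw [h1] at h
          have : (b.2 - a.2) * (z.1 - a.1) = 0 := by linarith
          exact (mul_eq_zero.1 this).resolve_left h2
        ext
        · simp only [vadd_eq_add, Prod.fst_add, Prod.smul_fst, Prod.fst_sub, smul_eq_mul, h1]
          linarith
        · simp only [vadd_eq_add, Prod.snd_add, Prod.smul_snd, Prod.snd_sub, smul_eq_mul]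
          field_simp; ring
      · refine ⟨(z.1 - a.1) / (b.1 - a.1), ?_⟩
        ext
        · simp only [vadd_eq_add, Prod.fst_add, Prod.smul_fst, Prod.fst_sub, smul_eq_mul]
          field_simp; ring
        · simp only [vadd_eq_add, Prod.snd_add, Prod.smul_snd, Prod.snd_sub, smul_eq_mul]
          field_simp; linarith

theorem first_exists {α : Type*} (r : α → α → Prop) (s : Finset α)
    (tr : ∀ a ∈ s, ∀ b ∈ s, ∀ c ∈ s, r a b → r b c → r a c)
    (tot : ∀ a ∈ s, ∀ b ∈ s, a ≠ b → r a b ∨ r b a) (hne : s.Nonempty) :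
    ∃ m ∈ s, ∀ y ∈ s, y ≠ m → r m y := by
  induction s using Finset.induction_on with
  | empty => simp at hne
  | insert x t hx ih =>
    rcases t.eq_empty_or_nonempty with rfl | ht
    · exact ⟨x, by simp, by simp⟩
    · obtain ⟨m, hm, hmin⟩ := ih
        (fun a ha b hb c hc => tr a (by simp [ha]) b (by simp [hb]) c (by simp [hc]))
        (fun a ha b hb => tot a (by simp [ha]) b (by simp [hb])) ht
      have hxm : m ≠ x := by rintro rfl; exact hx hm
      rcases tot x (by simp) m (by simp [hm]) hxm.symm with h | h
      · refine ⟨x, by simp, fun y hy hyx => ?_⟩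
        have hy' : y ∈ t := (Finset.mem_insert.1 hy).resolve_left hyx
        by_cases e : y = m
        · rw [e]; exact h
        · exact tr x (by simp) m (by simp [hm]) y hy h (hmin y hy' e)
      · refine ⟨m, by simp [hm], fun y hy hym => ?_⟩
        rcases Finset.mem_insert.1 hy with rfl | hy'
        · exact h
        · exact hmin y hy' hym

theorem fan_exists {α : Type*} (r : α → α → Prop) (s : Finset α) (x0 : α)
    (tr : ∀ a ∈ s, ∀ b ∈ s, ∀ c ∈ s, r a b → r b c → r a c)
    (tot : ∀ a ∈ s, ∀ b ∈ s, a ≠ b → r a b ∨ r b a) (k : ℕ) (hk : k ≤ s.card) :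
    ∃ q : ℕ → α, (∀ i < k, q i ∈ s) ∧ (∀ i j, i < j → j < k → r (q i) (q j)) ∧
      ∀ y ∈ s, (∃ i < k, y = q i) ∨ ∀ i < k, r (q i) y := by
  induction k with
  | zero => exact ⟨fun _ => x0, by simp, by simp, by simp⟩
  | succ k ih =>
    obtain ⟨q, h1, h2, h3⟩ := ih (by omega)
    have hne : (s.filter (fun y => ¬ ∃ i < k, y = q i)).Nonempty := by
      by_contra hne
      rw [Finset.not_nonempty_iff_eq_empty, Finset.filter_eq_empty_iff] at hne
      have : s ⊆ (Finset.range k).image q := by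
        intro y hy
        have := hne hy
        rw [not_not] at this
        obtain ⟨i, hi, rfl⟩ := this
        exact Finset.mem_image.2 ⟨i, by simpa using hi, rfl⟩
      have h5 := (Finset.card_le_card this).trans Finset.card_image_le
      rw [Finset.card_range] at h5
      omega
    obtain ⟨m, hm, hmin⟩ := first_exists r _
      (fun a ha b hb c hc => tr a (Finset.mem_filter.1 ha).1 b (Finset.mem_filter.1 hb).1
        c (Finset.mem_filter.1 hc).1)
      (fun a ha b hb => tot a (Finset.mem_filter.1 ha).1 b (Finset.mem_filter.1 hb).1) hne
    obtain ⟨hms, hmq⟩ := Finset.mem_filter.1 hm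
    have e1 : ∀ i, i < k → Function.update q k m i = q i := by
      intro i hi; rw [Function.update_of_ne (by omega)]
    have e2 : Function.update q k m k = m := Function.update_self ..
    refine ⟨Function.update q k m, ?_, ?_, ?_⟩
    · intro i hi
      rcases Nat.lt_succ_iff_lt_or_eq.1 hi with hi | rfl
      · rw [e1 i hi]; exact h1 i hi
      · rw [e2]; exact hms
    · intro i j hij hj
      rcases Nat.lt_succ_iff_lt_or_eq.1 hj with hj | rfl
      · rw [e1 i (by omega), e1 j hj]; exact h2 i j hij hj
      · rw [e1 i hij, e2]
        exact ((h3 m hms).resolve_left hmq) i hij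
    · intro y hy
      rcases h3 y hy with ⟨i, hi, rfl⟩ | h
      · exact Or.inl ⟨i, by omega, (e1 i hi).symm⟩
      · by_cases hym : y = m
        · exact Or.inl ⟨k, by omega, by rw [e2, hym]⟩
        · by_cases hyq : ∃ i < k, y = q i
          · obtain ⟨i, hi, rfl⟩ := hyq
            exact Or.inl ⟨i, by omega, (e1 i hi).symm⟩
          · refine Or.inr fun i hi => ?_
            rcases Nat.lt_succ_iff_lt_or_eq.1 hi with hi | rfl
            · rw [e1 i hi]; exact h i hi
            · rw [e2]; exact hmin y (Finset.mem_filter.2 ⟨hy, hyq⟩) hym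

/-- the lexicographic half plane of points greater than `p` -/
def LexGt (p z : Pt) : Prop := p.1 < z.1 ∨ (p.1 = z.1 ∧ p.2 < z.2)

theorem lex_min (P : Finset Pt) (h : P.Nonempty) : ∃ p ∈ P, ∀ y ∈ P, y ≠ p → LexGt p y := by
  refine first_exists LexGt P ?_ ?_ h
  · intro a _ b _ c _ h1 h2
    rcases h1 with h1 | ⟨h1, h1'⟩ <;> rcases h2 with h2 | ⟨h2, h2'⟩
    · exact Or.inl (by linarith)
    · exact Or.inl (by linarith)
    · exact Or.inl (by linarith)
    · exact Or.inr ⟨by linarith, by linarith⟩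
  · intro a _ b _ hab
    rcases lt_trichotomy a.1 b.1 with h | h | h
    · exact Or.inl (Or.inl h)
    · rcases lt_trichotomy a.2 b.2 with h' | h' | h'
      · exact Or.inl (Or.inr ⟨h, h'⟩)
      · exact absurd (Prod.ext h h') hab
      · exact Or.inr (Or.inr ⟨h.symm, h'⟩)
    · exact Or.inr (Or.inl h)

theorem lex_trans (p a b c : Pt) (ha : LexGt p a) (hb : LexGt p b) (hc : LexGt p c)
    (h1 : 0 < dt p a b) (h2 : 0 < dt p b c) : 0 < dt p a c := by
  have key : (b.1 - p.1) * dt p a c = (a.1 - p.1) * dt p b c + (c.1 - p.1) * dt p a b := by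
    unfold dt; ring
  have a0 : 0 ≤ a.1 - p.1 := by rcases ha with h | h <;> linarith
  have c0 : 0 ≤ c.1 - p.1 := by rcases hc with h | h <;> linarith
  rcases hb with hb | ⟨hb, hb'⟩
  · have b0 : 0 < b.1 - p.1 := by linarith
    refine pos_of_mul_pos_right (b := dt p a c) (a := b.1 - p.1) ?_ b0.le
    rw [key]
    rcases ha with ha | ⟨ha, ha'⟩
    · have : 0 < (a.1 - p.1) * dt p b c := mul_pos (by linarith) h2
      have := mul_nonneg c0 h1.le
      linarith
    · exfalso
      unfold dt at h1
      have : a.1 - p.1 = 0 := by linarith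
      rw [this] at h1
      have := mul_pos (sub_pos.2 ha') b0
      linarith
  · exfalso
    unfold dt at h2
    have : b.1 - p.1 = 0 := by linarith
    rw [this] at h2
    have := mul_nonneg (sub_pos.2 hb').le c0
    linarith

theorem lex_hull (p : Pt) (T : Set Pt) (h : ∀ z ∈ T, LexGt p z) : p ∉ convexHull ℝ T := by
  intro hp
  have hc : Convex ℝ {z : Pt | LexGt p z} := by
    intro x hx y hy a b ha hb hab
    rcases ha.eq_or_lt with rfl | ha
    · have : b = 1 := by linarith
      subst this; simpa using hy
    rcases hb.eq_or_lt with rfl | hb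
    · have : a = 1 := by linarith
      subst this; simpa using hx
    have hbb : b = 1 - a := by linarith
    have hx : LexGt p x := hx
    have hy : LexGt p y := hy
    show LexGt p (a • x + b • y)
    unfold LexGt at *
    simp only [Prod.fst_add, Prod.smul_fst, smul_eq_mul, Prod.snd_add, Prod.smul_snd]
    have e1 : ∀ u v w : ℝ, a * u + b * v - w = a * (u - w) + b * (v - w) := by
      intro u v w; rw [hbb]; ring
    rcases hx with hx | ⟨hx, hx'⟩ <;> rcases hy with hy | ⟨hy, hy'⟩
    · left
      have := e1 x.1 y.1 p.1
      have := mul_pos ha (sub_pos.2 hx)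
      have := mul_pos hb (sub_pos.2 hy)
      linarith
    · left
      have := e1 x.1 y.1 p.1
      have := mul_pos ha (sub_pos.2 hx)
      rw [← hy] at *
      linarith
    · left
      have := e1 x.1 y.1 p.1
      have := mul_pos hb (sub_pos.2 hy)
      rw [← hx] at *
      linarith
    · right
      constructor
      · rw [← hx, ← hy, hbb]; ring
      · have := e1 x.2 y.2 p.2
        have := mul_pos ha (sub_pos.2 hx')
        have := mul_pos hb (sub_pos.2 hy')
        linarith
  have : LexGt p p := convexHull_min (s := T) (t := {z : Pt | LexGt p z}) h hc hp
  rcases this with h | h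
  · exact lt_irrefl _ h
  · exact lt_irrefl _ h.2

theorem removal (P Q : Finset Pt) (hQ : Q ⊆ P)
    (hout : ∀ y ∈ P, y ∉ Q → y ∉ convexHull ℝ (Q : Set Pt)) (T : Finset (Finset Pt))
    (hT : ∀ S ∈ T, IsHole 5 P S ∧ ¬ S ⊆ Q) : numHoles 5 Q + T.card ≤ numHoles 5 P := by
  unfold numHoles
  rw [← Finset.card_union_of_disjoint]
  · apply Finset.card_le_card
    intro S hS
    rw [Finset.mem_filter, Finset.mem_powerset]
    rcases Finset.mem_union.1 hS with hS | hS
    · obtain ⟨_, h1, h2, h3, h4⟩ := Finset.mem_filter.1 hS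
      refine ⟨h1.trans hQ, h1.trans hQ, h2, h3, fun y hy hyS => ?_⟩
      by_cases hyQ : y ∈ Q
      · exact h4 y hyQ hyS
      · exact absurd (convexHull_mono (Finset.coe_subset.2 h1) hyS) (hout y hy hyQ)
    · exact ⟨(hT S hS).1.1, (hT S hS).1⟩
  · rw [Finset.disjoint_left]
    intro S hS hS'
    exact (hT S hS').2 (Finset.mem_powerset.1 (Finset.mem_filter.1 hS).1)


/-! ## Fans -/

structure Fan (P : Finset Pt) (p : Pt) (q : ℕ → Pt) : Prop where
  hp : p ∈ P
  hq : ∀ i < 11, q i ∈ P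
  ord : ∀ i j, i < j → j < 11 → 0 < dt p (q i) (q j)
  rest : ∀ y ∈ P, y = p ∨ (∃ i < 11, y = q i) ∨ ∀ i < 11, 0 < dt p (q i) y
  gp : ∀ a b c, a < b → b < c → c < 11 → dt (q a) (q b) (q c) ≠ 0

def XX (q : ℕ → Pt) (a b c : ℕ) : Bool := decide (0 < dt (q a) (q b) (q c))

theorem XX_true {q : ℕ → Pt} {a b c : ℕ} : XX q a b c = true ↔ 0 < dt (q a) (q b) (q c) := by
  unfold XX; simp

theorem Fan.XX_false {P p q} (F : Fan P p q) {a b c : ℕ} (h1 : a < b) (h2 : b < c) (h3 : c < 11) :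
    XX q a b c = false ↔ dt (q a) (q b) (q c) < 0 := by
  have := F.gp a b c h1 h2 h3
  unfold XX
  simp only [decide_eq_false_iff_not, not_lt]
  exact ⟨fun h => lt_of_le_of_ne h this, le_of_lt⟩

theorem Fan.inj {P p q} (F : Fan P p q) {i j : ℕ} (hi : i < 11) (hj : j < 11) (h : q i = q j) :
    i = j := by
  rcases lt_trichotomy i j with h' | h' | h'
  · have := F.ord i j h' hj
    rw [h, dt_self1] at this; exact absurd this (lt_irrefl _)
  · exact h'
  · have := F.ord j i h' hi
    rw [h, dt_self1] at this; exact absurd this (lt_irrefl _)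

theorem Fan.signotope {P p q} (F : Fan P p q) (a b c d : ℕ) (hab : a < b) (hbc : b < c)
    (hcd : c < d) (hd : d < 11) :
    sg (XX q a b c) (XX q a b d) (XX q a c d) (XX q b c d) = true := by
  have g1 := F.ord a b hab (by omega)
  have g2 := F.ord a c (by omega) (by omega)
  have g3 := F.ord a d (by omega) (by omega)
  have g4 := F.ord b c (by omega) (by omega)
  have g5 := F.ord b d (by omega) (by omega)
  have g6 := F.ord c d (by omega) (by omega)
  have n1 := F.XX_false hab hbc (by omega)
  have n2 := F.XX_false hab (hbc.trans hcd) hd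
  have n3 := F.XX_false (hab.trans hbc) hcd hd
  have n4 := F.XX_false hbc hcd hd
  have m1 := @XX_true q a b c
  have m2 := @XX_true q a b d
  have m3 := @XX_true q a c d
  have m4 := @XX_true q b c d
  have e1 : dt (q a) (q b) (q c) * dt p (q a) (q d) + dt (q a) (q c) (q d) * dt p (q a) (q b)
      = dt (q a) (q b) (q d) * dt p (q a) (q c) := by unfold dt; ring
  have e2 : dt (q a) (q b) (q c) * dt p (q b) (q d) + dt (q b) (q c) (q d) * dt p (q a) (q b)
      = dt (q a) (q b) (q d) * dt p (q b) (q c) := by unfold dt; ring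
  have e3 : dt (q a) (q b) (q c) * dt p (q c) (q d) + dt (q b) (q c) (q d) * dt p (q a) (q c)
      = dt (q a) (q c) (q d) * dt p (q b) (q c) := by unfold dt; ring
  have e4 : dt (q a) (q b) (q d) * dt p (q c) (q d) + dt (q b) (q c) (q d) * dt p (q a) (q d)
      = dt (q a) (q c) (q d) * dt p (q b) (q d) := by unfold dt; ring
  generalize dt (q a) (q b) (q c) = x1 at *
  generalize dt (q a) (q b) (q d) = x2 at *
  generalize dt (q a) (q c) (q d) = x3 at *
  generalize dt (q b) (q c) (q d) = x4 at *
  have aux : ∀ x y z u v w : ℝ, 0 < u → 0 < v → 0 < w → x * u + z * v = y * w →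
      (0 < x ∧ 0 < z → 0 < y) ∧ (x < 0 ∧ z < 0 → y < 0) := by
    intro x y z u v w hu hv hw h
    constructor
    · rintro ⟨hx, hz⟩
      have := mul_pos hx hu
      have := mul_pos hz hv
      exact pos_of_mul_pos_left (a := y) (b := w) (by linarith) hw.le
    · rintro ⟨hx, hz⟩
      have := mul_neg_of_neg_of_pos hx hu
      have := mul_neg_of_neg_of_pos hz hv
      by_contra hy
      have := mul_nonneg (not_lt.1 hy) hw.le
      linarith
  have f1 := aux _ _ _ _ _ _ g3 g1 g2 e1
  have f2 := aux _ _ _ _ _ _ g5 g1 g4 e2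
  have f3 := aux _ _ _ _ _ _ g6 g2 g4 e3
  have f4 := aux _ _ _ _ _ _ g6 g3 g5 e4
  rw [← m1, ← m2, ← m3, ← n1, ← n2, ← n3] at f1
  rw [← m1, ← m2, ← m4, ← n1, ← n2, ← n4] at f2
  rw [← m1, ← m3, ← m4, ← n1, ← n3, ← n4] at f3
  rw [← m2, ← m3, ← m4, ← n2, ← n3, ← n4] at f4
  clear * - f1 f2 f3 f4
  generalize XX q a b c = z1 at *
  generalize XX q a b d = z2 at *
  generalize XX q a c d = z3 at *
  generalize XX q b c d = z4 at *
  cases z1 <;> cases z2 <;> cases z3 <;> cases z4 <;>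
    first
      | rfl
      | exact absurd (f1.1 ⟨rfl, rfl⟩) Bool.noConfusion
      | exact absurd (f1.2 ⟨rfl, rfl⟩) Bool.noConfusion
      | exact absurd (f2.1 ⟨rfl, rfl⟩) Bool.noConfusion
      | exact absurd (f2.2 ⟨rfl, rfl⟩) Bool.noConfusion
      | exact absurd (f3.1 ⟨rfl, rfl⟩) Bool.noConfusion
      | exact absurd (f3.2 ⟨rfl, rfl⟩) Bool.noConfusion
      | exact absurd (f4.1 ⟨rfl, rfl⟩) Bool.noConfusion
      | exact absurd (f4.2 ⟨rfl, rfl⟩) Bool.noConfusion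

theorem edgeL_eq (a b c d : ℕ) (t1 t2 t3 s : Bool) (x : ℕ) : edgeL a b c d t1 t2 t3 s x =
    if d < x ∧ t3 = s then d else if c < x ∧ t2 = s then c else if b < x ∧ t1 = s then b else a := by
  have h1 := blt_iff d x
  have h2 := blt_iff c x
  have h3 := blt_iff b x
  unfold edgeL
  generalize blt d x = u at *
  generalize blt c x = v at *
  generalize blt b x = w at *
  simp only [← h1, ← h2, ← h3]
  cases u <;> cases v <;> cases w <;> cases t1 <;> cases t2 <;> cases t3 <;> cases s <;>
    simp [cnd, beqB]

theorem edgeR_eq (b c d e : ℕ) (t1 t2 t3 s : Bool) (x : ℕ) : edgeR b c d e t1 t2 t3 s x =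
    if x < b ∧ t1 = s then b else if x < c ∧ t2 = s then c else if x < d ∧ t3 = s then d else e := by
  have h1 := blt_iff x b
  have h2 := blt_iff x c
  have h3 := blt_iff x d
  unfold edgeR
  generalize blt x b = u at *
  generalize blt x c = v at *
  generalize blt x d = w at *
  simp only [← h1, ← h2, ← h3]
  cases u <;> cases v <;> cases w <;> cases t1 <;> cases t2 <;> cases t3 <;> cases s <;>
    simp [cnd, beqB]

theorem edge_sep {X : ℕ → ℕ → ℕ → Bool} {a b c d e : ℕ} {t1 t2 t3 : Bool} (hab : a < b)
    (hbc : b < c) (hcd : c < d) (hde : d < e) (C : Cvx X a b c d e t1 t2 t3) (x : ℕ) (hax : a < x)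
    (hxe : x < e) (s : Bool) (h1 : x = b → s = t1) (h2 : x = c → s = t2) (h3 : x = d → s = t3)
    (u w : ℕ) (hu : u = edgeL a b c d t1 t2 t3 s x) (hw : w = edgeR b c d e t1 t2 t3 s x) :
    u < x ∧ x < w ∧ w ≤ e ∧
    ((x = b ∨ x = c ∨ x = d) → X u x w = s) ∧
    ∀ j, (j = a ∨ j = b ∨ j = c ∨ j = d ∨ j = e) → j ≠ x → j = u ∨ j = w ∨ (j < u ∧ X j u w = s) ∨
      (u < j ∧ j < w ∧ X u j w = !s) ∨ (w < j ∧ X u w j = s) := by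
  obtain ⟨c1, c2, c3, c4, c5, c6, c7, c8, c9, c10⟩ := C
  have hu' : (u = d ∧ d < x ∧ t3 = s) ∨ (u = c ∧ c < x ∧ t2 = s ∧ (d < x → t3 = !s)) ∨
      (u = b ∧ b < x ∧ t1 = s ∧ (d < x → t3 = !s) ∧ (c < x → t2 = !s)) ∨
      (u = a ∧ (d < x → t3 = !s) ∧ (c < x → t2 = !s) ∧ (b < x → t1 = !s)) := by
    rw [edgeL_eq] at hu
    cases t1 <;> cases t2 <;> cases t3 <;> cases s <;> grind
  have hw' : (w = b ∧ x < b ∧ t1 = s) ∨ (w = c ∧ x < c ∧ t2 = s ∧ (x < b → t1 = !s)) ∨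
      (w = d ∧ x < d ∧ t3 = s ∧ (x < b → t1 = !s) ∧ (x < c → t2 = !s)) ∨
      (w = e ∧ (x < b → t1 = !s) ∧ (x < c → t2 = !s) ∧ (x < d → t3 = !s)) := by
    rw [edgeR_eq] at hw
    cases t1 <;> cases t2 <;> cases t3 <;> cases s <;> grind
  clear hu hw
  rcases hu' with ⟨rfl, hu⟩ | ⟨rfl, hu⟩ | ⟨rfl, hu⟩ | ⟨rfl, hu⟩ <;>
  rcases hw' with ⟨rfl, hw⟩ | ⟨rfl, hw⟩ | ⟨rfl, hw⟩ | ⟨rfl, hw⟩ <;>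
  first
    | (exfalso; omega)
    | (refine ⟨by omega, by omega, by omega, ?_, ?_⟩
       · rintro (rfl | rfl | rfl) <;> grind
       · rintro j (rfl | rfl | rfl | rfl | rfl) hj <;> grind)


theorem Fan.hole5 {P p q} (F : Fan P p q) (a b c d e : ℕ) (t1 t2 t3 : Bool) (hab : a < b)
    (hbc : b < c) (hcd : c < d) (hde : d < e) (he : e < 11) (C : Cvx (XX q) a b c d e t1 t2 t3)
    (hx : ∀ x, a < x → x < e → x ≠ b → x ≠ c → x ≠ d →
        ∃ s, XX q (edgeL a b c d t1 t2 t3 s x) x (edgeR b c d e t1 t2 t3 s x) = s) :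
    IsHole 5 P (({a, b, c, d, e} : Finset ℕ).image q) := by
  have hm : ∀ j ∈ ({a, b, c, d, e} : Finset ℕ), a ≤ j ∧ j ≤ e := by
    intro j hj
    simp only [Finset.mem_insert, Finset.mem_singleton] at hj
    omega
  apply hole_of
  · intro z hz
    obtain ⟨j, hj, rfl⟩ := Finset.mem_image.1 hz
    have := hm j hj
    exact F.hq j (by omega)
  · rw [Finset.card_image_of_injOn]
    · rw [Finset.card_insert_of_notMem, Finset.card_insert_of_notMem, Finset.card_insert_of_notMem,
        Finset.card_insert_of_notMem, Finset.card_singleton] <;>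
      simp only [Finset.mem_insert, Finset.mem_singleton] <;> omega
    · intro i hi j hj hij
      have := hm i hi
      have := hm j hj
      exact F.inj (by omega) (by omega) hij
  · intro y hy
    have hz : ∀ z ∈ ((({a, b, c, d, e} : Finset ℕ).image q : Finset Pt) : Set Pt) \ {y},
        ∃ j, (j = a ∨ j = b ∨ j = c ∨ j = d ∨ j = e) ∧ z = q j ∧ q j ≠ y := by
      rintro z ⟨h1, h2⟩
      obtain ⟨j, hj, rfl⟩ := Finset.mem_image.1 (Finset.mem_coe.1 h1)
      exact ⟨j, by simpa using hj, rfl, h2⟩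
    generalize ((({a, b, c, d, e} : Finset ℕ).image q : Finset Pt) : Set Pt) \ {y} = T at hz
    rcases F.rest y hy with rfl | ⟨x, hx11, rfl⟩ | hr
    · apply nh_sum y (q a) (q e)
      intro z hzT
      obtain ⟨j, hj, rfl, -⟩ := hz z hzT
      have g := F.ord a e (by omega) he
      rcases eq_or_ne j a with rfl | h1
      · rw [dt_self1]; linarith
      rcases eq_or_ne j e with rfl | h2
      · rw [dt_self1]; linarith
      have := F.ord a j (by omega) (by omega)
      have := F.ord j e (by omega) (by omega)
      linarith
    · rcases le_or_gt x a with hxa | hxa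
      · apply nh_pos p (q x) T _ _ (dt_self1 _ _).le
        intro z hzT
        obtain ⟨j, hj, rfl, hne⟩ := hz z hzT
        have : j ≠ x := by rintro rfl; exact hne rfl
        exact F.ord x j (by omega) (by omega)
      rcases le_or_gt e x with hxe | hxe
      · apply nh_pos (q x) p T _ _ (dt_self2 _ _).le
        intro z hzT
        obtain ⟨j, hj, rfl, hne⟩ := hz z hzT
        have : j ≠ x := by rintro rfl; exact hne rfl
        rw [dt_cyc, dt_cyc]
        exact F.ord j x (by omega) (by omega)
      have hs : ∃ s, (x = b → s = t1) ∧ (x = c → s = t2) ∧ (x = d → s = t3) ∧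
          XX q (edgeL a b c d t1 t2 t3 s x) x (edgeR b c d e t1 t2 t3 s x) = s := by
        by_cases h1 : x = b
        · have h2 : x = c → t1 = t2 := by omega
          have h3 : x = d → t1 = t3 := by omega
          exact ⟨t1, fun _ => rfl, h2, h3, (edge_sep hab hbc hcd hde C x hxa hxe t1 (fun _ => rfl)
            h2 h3 _ _ rfl rfl).2.2.2.1 (Or.inl h1)⟩
        by_cases h2 : x = c
        · have h2' : x = b → t2 = t1 := by omega
          have h3 : x = d → t2 = t3 := by omega
          exact ⟨t2, h2', fun _ => rfl, h3, (edge_sep hab hbc hcd hde C x hxa hxe t2 h2' (fun _ => rfl)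
            h3 _ _ rfl rfl).2.2.2.1 (Or.inr (Or.inl h2))⟩
        by_cases h3 : x = d
        · have h2' : x = b → t3 = t1 := by omega
          have h3' : x = c → t3 = t2 := by omega
          exact ⟨t3, h2', h3', fun _ => rfl, (edge_sep hab hbc hcd hde C x hxa hxe t3 h2' h3'
            (fun _ => rfl) _ _ rfl rfl).2.2.2.1 (Or.inr (Or.inr h3))⟩
        obtain ⟨s, hs⟩ := hx x hxa hxe h1 h2 h3
        exact ⟨s, fun h => absurd h h1, fun h => absurd h h2, fun h => absurd h h3, hs⟩
      obtain ⟨s, s1, s2, s3, hs⟩ := hs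
      obtain ⟨hux, hxw, hwe, -, hall⟩ := edge_sep hab hbc hcd hde C x hxa hxe s s1 s2 s3 _ _ rfl rfl
      generalize edgeL a b c d t1 t2 t3 s x = u at *
      generalize edgeR b c d e t1 t2 t3 s x = w at *
      cases s with
      | true =>
        rw [XX_true] at hs
        apply nh_nonneg (q u) (q w)
        · intro z hzT
          obtain ⟨j, hj, rfl, hne⟩ := hz z hzT
          have hjx : j ≠ x := by rintro rfl; exact hne rfl
          rcases hall j hj hjx with rfl | rfl | ⟨h1, h2⟩ | ⟨h1, h1', h2⟩ | ⟨h1, h2⟩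
          · rw [dt_self2]
          · rw [dt_self1]
          · rw [XX_true] at h2; rw [dt_cyc]; exact h2.le
          · rw [Bool.not_true, F.XX_false h1 h1' (by omega)] at h2; rw [dt_swap]; linarith
          · rw [XX_true] at h2; exact h2.le
        · rw [dt_swap]; linarith
      | false =>
        rw [F.XX_false hux hxw (by omega)] at hs
        apply nh_nonneg (q w) (q u)
        · intro z hzT
          obtain ⟨j, hj, rfl, hne⟩ := hz z hzT
          have hjx : j ≠ x := by rintro rfl; exact hne rfl
          rw [dt_swap']
          rcases hall j hj hjx with rfl | rfl | ⟨h1, h2⟩ | ⟨h1, h1', h2⟩ | ⟨h1, h2⟩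
          · rw [dt_self2]; simp
          · rw [dt_self1]; simp
          · rw [F.XX_false h1 (by omega) (by omega)] at h2; rw [dt_cyc]; linarith
          · rw [Bool.not_false, XX_true] at h2; rw [dt_swap]; linarith
          · rw [F.XX_false (by omega) h1 (by omega)] at h2; linarith
        · rw [dt_swap', dt_swap]; linarith
    · apply nh_pos y p T _ _ (dt_self2 _ _).le
      intro z hzT
      obtain ⟨j, hj, rfl, hne⟩ := hz z hzT
      rw [dt_cyc, dt_cyc]
      exact hr j (by omega)

theorem Fan.holeP {P p q} (F : Fan P p q) (a b c d : ℕ) (hab : a < b)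
    (hbc : b < c) (hcd : c < d) (hd : d < 11) (x1 : XX q a b c = true) (x2 : XX q b c d = true)
    (k1 : ∀ k, a < k → k < b → XX q a k b = true) (k2 : ∀ k, b < k → k < c → XX q b k c = true)
    (k3 : ∀ k, c < k → k < d → XX q c k d = true) :
    IsHole 5 P (insert p (({a, b, c, d} : Finset ℕ).image q)) := by
  have hm : ∀ j ∈ ({a, b, c, d} : Finset ℕ), a ≤ j ∧ j ≤ d := by
    intro j hj
    simp only [Finset.mem_insert, Finset.mem_singleton] at hj
    omega
  have hpq : ∀ j < 11, q j ≠ p := by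
    intro j hj h
    rcases Nat.eq_zero_or_pos j with rfl | h0
    · have := F.ord 0 1 (by omega) (by omega)
      rw [h, dt_self3] at this; exact lt_irrefl _ this
    · have := F.ord 0 j h0 hj
      rw [h, dt_self2] at this; exact lt_irrefl _ this
  have S := F.signotope a b c d hab hbc hcd hd
  have x34 : XX q a b d = true ∧ XX q a c d = true := by
    rw [x1, x2] at S
    generalize XX q a b d = z1 at *
    generalize XX q a c d = z2 at *
    clear * - S
    revert S
    cases z1 <;> cases z2 <;> simp [sg]
  obtain ⟨x3, x4⟩ := x34
  rw [XX_true] at x1 x2 x3 x4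
  apply hole_of
  · intro z hz
    rcases Finset.mem_insert.1 hz with rfl | hz
    · exact F.hp
    obtain ⟨j, hj, rfl⟩ := Finset.mem_image.1 hz
    have := hm j hj
    exact F.hq j (by omega)
  · rw [Finset.card_insert_of_notMem, Finset.card_image_of_injOn]
    · rw [Finset.card_insert_of_notMem, Finset.card_insert_of_notMem, Finset.card_insert_of_notMem,
        Finset.card_singleton] <;>
      simp only [Finset.mem_insert, Finset.mem_singleton] <;> omega
    · intro i hi j hj hij
      have := hm i hi
      have := hm j hj
      exact F.inj (by omega) (by omega) hij
    · intro h
      obtain ⟨j, hj, h⟩ := Finset.mem_image.1 h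
      have := hm j hj
      exact hpq j (by omega) h
  · intro y hy
    have hz : ∀ z ∈ ((insert p (({a, b, c, d} : Finset ℕ).image q) : Finset Pt) : Set Pt) \ {y},
        (z = p ∧ p ≠ y) ∨ ∃ j, (j = a ∨ j = b ∨ j = c ∨ j = d) ∧ z = q j ∧ q j ≠ y := by
      rintro z ⟨h1, h2⟩
      rcases Finset.mem_insert.1 (Finset.mem_coe.1 h1) with rfl | h1
      · exact Or.inl ⟨rfl, h2⟩
      obtain ⟨j, hj, rfl⟩ := Finset.mem_image.1 h1
      exact Or.inr ⟨j, by simpa using hj, rfl, h2⟩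
    generalize ((insert p (({a, b, c, d} : Finset ℕ).image q) : Finset Pt) : Set Pt) \ {y} = T at hz
    -- reduce to functionals given by an edge
    have edge : ∀ u w, u < w → w < 11 → dt (q u) (q w) y < 0 →
        (∀ j, (j = a ∨ j = b ∨ j = c ∨ j = d) → q j ≠ y → 0 ≤ dt (q u) (q w) (q j)) →
        y ∉ convexHull ℝ T := by
      intro u w huw hw h1 h2
      apply nh_nonneg (q u) (q w) _ _ _ h1
      intro z hzT
      rcases hz z hzT with ⟨rfl, -⟩ | ⟨j, hj, rfl, hne⟩
      · rw [dt_cyc]; exact (F.ord u w huw hw).le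
      · exact h2 j hj hne
    have low : ∀ u, u < 11 → dt p (q u) y < 0 →
        (∀ j, (j = a ∨ j = b ∨ j = c ∨ j = d) → q j ≠ y → u ≤ j) → y ∉ convexHull ℝ T := by
      intro u hu h1 h2
      apply nh_nonneg p (q u) _ _ _ h1
      intro z hzT
      rcases hz z hzT with ⟨rfl, -⟩ | ⟨j, hj, rfl, hne⟩
      · rw [dt_self2]
      · rcases (h2 j hj hne).eq_or_lt with rfl | h
        · rw [dt_self1]
        · exact (F.ord u j h (by omega)).le
    have high : ∀ u, u < 11 → 0 < dt p (q u) y →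
        (∀ j, (j = a ∨ j = b ∨ j = c ∨ j = d) → q j ≠ y → j ≤ u) → y ∉ convexHull ℝ T := by
      intro u hu h1 h2
      apply nh_nonneg (q u) p _ _ _ (by rw [dt_swap']; linarith)
      intro z hzT
      rcases hz z hzT with ⟨rfl, -⟩ | ⟨j, hj, rfl, hne⟩
      · rw [dt_self1]
      · rw [dt_cyc, dt_cyc]
        rcases (h2 j hj hne).eq_or_lt with rfl | h
        · rw [dt_self1]
        · exact (F.ord j u h (by omega)).le
    rcases F.rest y hy with rfl | ⟨x, hx11, rfl⟩ | hr
    · apply nh_sum y (q a) (q d)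
      intro z hzT
      rcases hz z hzT with ⟨rfl, h⟩ | ⟨j, hj, rfl, -⟩
      · exact absurd rfl h
      have g := F.ord a d (by omega) hd
      rcases eq_or_ne j a with rfl | h1
      · rw [dt_self1]; linarith
      rcases eq_or_ne j d with rfl | h2
      · rw [dt_self1]; linarith
      have := F.ord a j (by omega) (by omega)
      have := F.ord j d (by omega) (by omega)
      linarith
    · have hne : ∀ j, q j ≠ q x → j ≠ x := by rintro j h rfl; exact h rfl
      have lowx : ∀ u, x < u → u < 11 → dt p (q u) (q x) < 0 := by
        intro u h h'; rw [dt_swap]; have := F.ord x u h h'; linarith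
      rcases lt_trichotomy x a with h | h | h
      · exact low a (by omega) (lowx a h (by omega)) (fun j hj _ => by omega)
      · refine low b (by omega) (lowx b (by omega) (by omega)) (fun j hj h => ?_)
        have := hne j h
        omega
      rcases lt_trichotomy d x with h' | h' | h'
      · exact high d (by omega) (F.ord d x h' hx11) (fun j hj _ => by omega)
      · refine high c (by omega) (F.ord c x (by omega) hx11) (fun j hj h => ?_)
        have := hne j h
        omega
      rcases lt_trichotomy x b with h1 | h1 | h1
      · have := k1 x h h1
        rw [XX_true] at this
        refine edge a b hab (by omega) (by rw [dt_swap]; linarith) ?_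
        rintro j (rfl | rfl | rfl | rfl) hj
        · rw [dt_self2]
        · rw [dt_self1]
        · exact x1.le
        · exact x3.le
      · subst h1
        refine edge a c (by omega) (by omega) (by rw [dt_swap]; linarith) ?_
        rintro j (rfl | rfl | rfl | rfl) hj
        · rw [dt_self2]
        · exact absurd rfl hj
        · rw [dt_self1]
        · exact x4.le
      rcases lt_trichotomy x c with h2 | h2 | h2
      · have := k2 x h1 h2
        rw [XX_true] at this
        refine edge b c hbc (by omega) (by rw [dt_swap]; linarith) ?_
        rintro j (rfl | rfl | rfl | rfl) hj
        · rw [dt_cyc]; exact x1.le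
        · rw [dt_self2]
        · rw [dt_self1]
        · exact x2.le
      · subst h2
        refine edge b d (by omega) (by omega) (by rw [dt_swap]; linarith) ?_
        rintro j (rfl | rfl | rfl | rfl) hj
        · rw [dt_cyc]; exact x3.le
        · rw [dt_self2]
        · exact absurd rfl hj
        · rw [dt_self1]
      · have := k3 x h2 h'
        rw [XX_true] at this
        refine edge c d hcd (by omega) (by rw [dt_swap]; linarith) ?_
        rintro j (rfl | rfl | rfl | rfl) hj
        · rw [dt_cyc]; exact x4.le
        · rw [dt_cyc]; exact x2.le
        · rw [dt_self2]
        · rw [dt_self1]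
    · exact high d hd (hr d hd) (fun j hj _ => by omega)


/-! ## Bit sets -/

def bs (n : ℕ) : Finset ℕ := n.bitIndices.toFinset

theorem bs_sum5 {a b c d e : ℕ} (hab : a < b) (hbc : b < c) (hcd : c < d) (hde : d < e) :
    bs (sum5 a b c d e) = {a, b, c, d, e} := by
  have h : sum5 a b c d e = ∑ i ∈ ({a, b, c, d, e} : Finset ℕ), 2 ^ i := by
    rw [Finset.sum_insert, Finset.sum_insert, Finset.sum_insert, Finset.sum_insert,
      Finset.sum_singleton] <;>
      first
        | rfl
        | (simp only [Finset.mem_insert, Finset.mem_singleton]; omega)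
  unfold bs
  rw [h]
  exact Finset.toFinset_bitIndices_sum_two_pow _

theorem bs_eq (n : ℕ) : ∑ i ∈ bs n, 2 ^ i = n := Finset.sum_toFinset_bitIndices_two_pow n

theorem bs_lt {n i : ℕ} (hn : n < 2048) (hi : i ∈ bs n) : i < 11 := by
  have h1 : 2 ^ i ≤ ∑ i ∈ bs n, 2 ^ i :=
    Finset.single_le_sum (f := fun i => 2 ^ i) (fun _ _ => Nat.zero_le _) hi
  rw [bs_eq] at h1
  by_contra h
  have : 2 ^ 11 ≤ 2 ^ i := Nat.pow_le_pow_right (by omega) (by omega)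
  omega

theorem bs_touch {n k : ℕ} (hn : n % 2 ^ k ≠ 0) : ∃ i < k, i ∈ bs n := by
  by_contra h
  push Not at h
  apply hn
  apply Nat.mod_eq_zero_of_dvd
  rw [← bs_eq n]
  apply Finset.dvd_sum
  intro i hi
  apply pow_dvd_pow
  by_contra h'
  exact h i (by omega) hi

theorem bs_inj {P p q} (F : Fan P p q) {m n : ℕ} (hm : m < 2048) (hn : n < 2048)
    (h : (bs m).image q = (bs n).image q) : m = n := by
  have key : ∀ m n, m < 2048 → n < 2048 → (bs m).image q = (bs n).image q → bs m ⊆ bs n := by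
    intro m n hm hn h i hi
    have : q i ∈ (bs n).image q := by rw [← h]; exact Finset.mem_image_of_mem q hi
    obtain ⟨j, hj, hji⟩ := Finset.mem_image.1 this
    rw [← F.inj (bs_lt hn hj) (bs_lt hm hi) hji]; exact hj
  rw [← bs_eq m, ← bs_eq n, (key m n hm hn h).antisymm (key n m hn hm h.symm)]

/-! ## The main step -/

theorem Fan.good {P p q} (F : Fan P p q) (hno : ∀ S, IsHole 5 P S → p ∉ S) :
    ∃ k, k < 11 ∧ 0 < k ∧ ∃ T : Finset (Finset Pt), 2 * T.card = k ∧
      ∀ S ∈ T, IsHole 5 P S ∧ ∃ i < k, q i ∈ S := by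
  by_contra hg
  push Not at hg
  refine core (XX q) (fun n => IsHole 5 P ((bs n).image q)) F.signotope ?_ ?_ ?_ ?_ ?_
  · intro a b c d hab hbc hcd hd x1 x2 k1 k2 k3
    exact hno _ (F.holeP a b c d hab hbc hcd hd x1 x2 k1 k2 k3) (Finset.mem_insert_self _ _)
  · intro a b c d e t1 t2 t3 hab hbc hcd hde he C hx
    show IsHole 5 P _
    rw [bs_sum5 hab hbc hcd hde]
    exact F.hole5 a b c d e t1 t2 t3 hab hbc hcd hde he C hx
  · intro a b c d e hab hbc hcd hde he ha h
    obtain ⟨S, hS, h1⟩ := hg 2 (by omega) (by omega) {(bs (sum5 a b c d e)).image q} (by simp)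
    rw [Finset.mem_singleton] at hS
    subst hS
    refine h1 h a ha ?_
    rw [bs_sum5 hab hbc hcd hde]
    exact Finset.mem_image_of_mem q (by simp)
  · intro m n hmn hm hn hm' hn' h1 h2
    have d1 : (bs m).image q ≠ (bs n).image q := fun h => hmn (bs_inj F hm' hn' h)
    obtain ⟨S, hS, h3⟩ := hg 4 (by omega) (by omega) {(bs m).image q, (bs n).image q}
      (by rw [Finset.card_pair d1])
    simp only [Finset.mem_insert, Finset.mem_singleton] at hS
    rcases hS with rfl | rfl
    · obtain ⟨i, hi, hi'⟩ := bs_touch (k := 4) hm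
      exact h3 h1 i hi (Finset.mem_image_of_mem q hi')
    · obtain ⟨i, hi, hi'⟩ := bs_touch (k := 4) hn
      exact h3 h2 i hi (Finset.mem_image_of_mem q hi')
  · intro m n k hmn hmk hnk hm hn hk hm' hn' hk' h1 h2 h4
    have d1 : (bs m).image q ≠ (bs n).image q := fun h => hmn (bs_inj F hm' hn' h)
    have d2 : (bs m).image q ≠ (bs k).image q := fun h => hmk (bs_inj F hm' hk' h)
    have d3 : (bs n).image q ≠ (bs k).image q := fun h => hnk (bs_inj F hn' hk' h)
    obtain ⟨S, hS, h3⟩ := hg 6 (by omega) (by omega)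
      {(bs m).image q, (bs n).image q, (bs k).image q}
      (by rw [Finset.card_eq_three.2 ⟨_, _, _, d1, d2, d3, rfl⟩])
    simp only [Finset.mem_insert, Finset.mem_singleton] at hS
    rcases hS with rfl | rfl | rfl
    · obtain ⟨i, hi, hi'⟩ := bs_touch (k := 6) hm
      exact h3 h1 i hi (Finset.mem_image_of_mem q hi')
    · obtain ⟨i, hi, hi'⟩ := bs_touch (k := 6) hn
      exact h3 h2 i hi (Finset.mem_image_of_mem q hi')
    · obtain ⟨i, hi, hi'⟩ := bs_touch (k := 6) hk
      exact h3 h4 i hi (Finset.mem_image_of_mem q hi')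

theorem exists_fan (P : Finset Pt) (hP : GenPos P) (hc : 12 ≤ P.card) (p : Pt) (hp : p ∈ P)
    (hmin : ∀ y ∈ P, y ≠ p → LexGt p y) : ∃ q, Fan P p q := by
  have hs : ∀ y ∈ P.erase p, y ∈ P ∧ y ≠ p ∧ LexGt p y := fun y hy =>
    ⟨Finset.mem_of_mem_erase hy, Finset.ne_of_mem_erase hy,
      hmin y (Finset.mem_of_mem_erase hy) (Finset.ne_of_mem_erase hy)⟩
  obtain ⟨q, h1, h2, h3⟩ := fan_exists (fun a b => 0 < dt p a b) (P.erase p) p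
    (fun a ha b hb c hc h h' => lex_trans p a b c (hs a ha).2.2 (hs b hb).2.2 (hs c hc).2.2 h h')
    (fun a ha b hb hab => by
      have := dt_ne P hP p a b hp (hs a ha).1 (hs b hb).1 (hs a ha).2.1.symm (hs b hb).2.1.symm hab
      rcases lt_or_gt_of_ne this with h | h
      · right; show 0 < dt p b a; rw [dt_swap]; linarith
      · left; exact h) 11 (by rw [Finset.card_erase_of_mem hp]; omega)
  have hne : ∀ i j, i < j → j < 11 → q i ≠ q j := by
    intro i j hij hj h
    have : 0 < dt p (q i) (q j) := h2 i j hij hj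
    rw [h, dt_self1] at this
    exact lt_irrefl _ this
  refine ⟨q, hp, fun i hi => (hs _ (h1 i hi)).1, h2, ?_, ?_⟩
  · intro y hy
    by_cases e : y = p
    · exact Or.inl e
    · exact Or.inr (h3 y (Finset.mem_erase.2 ⟨e, hy⟩))
  · intro a b c hab hbc hc
    exact dt_ne P hP _ _ _ (hs _ (h1 a (by omega))).1 (hs _ (h1 b (by omega))).1
      (hs _ (h1 c (by omega))).1 (hne a b hab (by omega)) (hne a c (by omega) hc) (hne b c hbc hc)

theorem GenPos.mono {P Q : Finset Pt} (h : GenPos P) (hQ : Q ⊆ P) : GenPos Q :=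
  fun S hS => h S (hS.trans hQ)

theorem main_bound : ∀ (n : ℕ) (P : Finset Pt), P.card = n → GenPos P →
    n ≤ 2 * numHoles 5 P + 11 := by
  intro n
  induction n using Nat.strong_induction_on with
  | _ n ih =>
  intro P hn hP
  by_cases hc : n ≤ 11
  · omega
  obtain ⟨p, hp, hmin⟩ := lex_min P (Finset.card_pos.1 (by omega))
  by_cases hh : ∃ S, IsHole 5 P S ∧ p ∈ S
  · obtain ⟨S, hS, hpS⟩ := hh
    have hsub : P.erase p ⊆ P := Finset.erase_subset p P
    have h1 := removal P (P.erase p) hsub (fun y hy hy' => by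
      have : y = p := by
        by_contra h; exact hy' (Finset.mem_erase.2 ⟨h, hy⟩)
      subst this
      apply lex_hull
      intro z hz
      have hz' := Finset.mem_coe.1 hz
      exact hmin z (hsub hz') (Finset.ne_of_mem_erase hz')) {S} (fun S' hS' => by
        rw [Finset.mem_singleton] at hS'
        subst hS'
        exact ⟨hS, fun h => Finset.notMem_erase p P (h hpS)⟩)
    rw [Finset.card_singleton] at h1
    have hcard : (P.erase p).card = n - 1 := by rw [Finset.card_erase_of_mem hp, hn]
    have h2 := ih (n - 1) (by omega) (P.erase p) hcard (hP.mono hsub)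
    omega
  · push Not at hh
    obtain ⟨q, F⟩ := exists_fan P hP (by omega) p hp hmin
    obtain ⟨k, hk, hk0, T, hT, hT'⟩ := F.good hh
    have hsub : P \ (Finset.range k).image q ⊆ P := Finset.sdiff_subset
    have h1 := removal P (P \ (Finset.range k).image q) hsub (fun y hy hy' => by
      have : y ∈ (Finset.range k).image q := by
        by_contra h; exact hy' (Finset.mem_sdiff.2 ⟨hy, h⟩)
      obtain ⟨i, hi, rfl⟩ := Finset.mem_image.1 this
      rw [Finset.mem_range] at hi
      apply nh_nonneg p (q k)
      · intro z hz
        obtain ⟨hz1, hz2⟩ := Finset.mem_sdiff.1 (Finset.mem_coe.1 hz)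
        rcases F.rest z hz1 with rfl | ⟨j, hj, rfl⟩ | h
        · rw [dt_self2]
        · have hjk : k ≤ j := by
            by_contra h
            exact hz2 (Finset.mem_image_of_mem q (Finset.mem_range.2 (by omega)))
          rcases hjk.eq_or_lt with rfl | h
          · rw [dt_self1]
          · exact (F.ord k j h hj).le
        · exact (h k hk).le
      · rw [dt_swap]
        have := F.ord i k hi hk
        linarith) T (fun S hS => by
        obtain ⟨h1, i, hi, h2⟩ := hT' S hS
        refine ⟨h1, fun h => ?_⟩
        exact (Finset.mem_sdiff.1 (h h2)).2 (Finset.mem_image_of_mem q (Finset.mem_range.2 hi)))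
    have him : (Finset.range k).image q ⊆ P := by
      intro z hz
      obtain ⟨i, hi, rfl⟩ := Finset.mem_image.1 hz
      rw [Finset.mem_range] at hi
      exact F.hq i (by omega)
    have hcard : (P \ (Finset.range k).image q).card = n - k := by
      rw [Finset.card_sdiff_of_subset him, hn, Finset.card_image_of_injOn, Finset.card_range]
      intro i hi j hj hij
      have hi' := Finset.mem_range.1 (Finset.mem_coe.1 hi)
      have hj' := Finset.mem_range.1 (Finset.mem_coe.1 hj)
      exact F.inj (by omega) (by omega) hij
    have h2 := ih (n - k) (by omega) _ hcard (hP.mono hsub)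
    omega

/-- `X₅(n) ≥ n/2 − O(1)`. -/
theorem stmt_0 :
    ∃ (C : ℝ) (n₀ : ℕ), ∀ n : ℕ, n₀ ≤ n → ∀ P : Finset Pt,
      P.card = n → GenPos P → (n : ℝ) / 2 - C ≤ (numHoles 5 P : ℝ) := by
  refine ⟨11 / 2, 0, fun n _ P hn hP => ?_⟩
  have h := main_bound n P hn hP
  have h' : (n : ℝ) ≤ 2 * (numHoles 5 P : ℝ) + 11 := by exact_mod_cast h
  linarith
end
end

section
/- Let P be a set of n points in general position in the plane ℝ², and let j be an integer with 0 ≤ j ≤ n − 2. Then there exist distinct points x, y ∈ P such that the open halfplane L(xy) to the left of the oriented line xy contains exactly j points of P, i.e., P has a j-edge. -/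
open scoped Classical

noncomputable section

theorem aux_trans {a b c d e f : ℝ} (ha : 0 < a ∨ (a = 0 ∧ 0 < b)) (hc : 0 < c ∨ (c = 0 ∧ 0 < d))
    (he : 0 < e ∨ (e = 0 ∧ 0 < f)) (h1 : 0 < a * d - b * c) (h2 : 0 < c * f - d * e) :
    0 < a * f - b * e := by
  have he0 : 0 ≤ e := by rcases he with h | ⟨h, _⟩ <;> linarith
  have hc0 : 0 < c := by
    rcases hc with h | ⟨h, h'⟩
    · exact h
    · subst h; nlinarith [mul_nonneg h'.le he0]
  have ha0 : 0 < a := by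
    rcases ha with h | ⟨h, h'⟩
    · exact h
    · subst h; nlinarith [mul_pos h' hc0]
  have : 0 < c * (a * f - b * e) := by
    have h3 := mul_pos ha0 h2
    have h4 := mul_nonneg he0 h1.le
    linarith
  exact (mul_pos_iff_of_pos_left hc0).mp this

theorem aux_coll {x p q : Pt} (hp : p ≠ x)
    (h : (p.1 - x.1) * (q.2 - x.2) - (p.2 - x.2) * (q.1 - x.1) = 0) :
    Collinear ℝ ({x, p, q} : Set Pt) := by
  rw [collinear_iff_of_mem (p₀ := x) (by simp)]
  refine ⟨p - x, ?_⟩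
  intro z hz
  simp only [Set.mem_insert_iff, Set.mem_singleton_iff] at hz
  rcases hz with rfl | rfl | rfl
  · exact ⟨0, by simp⟩
  · exact ⟨1, by simp⟩
  · by_cases h1 : p.1 - x.1 = 0
    · have h2 : p.2 - x.2 ≠ 0 := fun h2 => hp (Prod.ext (by linarith) (by linarith))
      refine ⟨(z.2 - x.2) / (p.2 - x.2), ?_⟩
      have h3 : z.1 - x.1 = 0 := by
        rw [h1] at h
        have : (p.2 - x.2) * (z.1 - x.1) = 0 := by linarith
        exact (mul_eq_zero.mp this).resolve_left h2
      ext
      · simp [h1]; linarith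
      · simp; field_simp; ring
    · refine ⟨(z.1 - x.1) / (p.1 - x.1), ?_⟩
      ext
      · simp; field_simp; ring
      · simp; field_simp; linarith

/-- a set of `n` points in general position has a `j`-edge for every
`0 ≤ j ≤ n − 2`. -/
theorem stmt_5 (n : ℕ) (P : Finset Pt) (hcard : P.card = n) (hgp : GenPos P)
    (j : ℕ) (hj : j + 2 ≤ n) :
    ∃ x ∈ P, ∃ y ∈ P, x ≠ y ∧ IsJEdge j P x y := by
  have hne : P.Nonempty := Finset.card_pos.mp (by omega)
  obtain ⟨x, hx, hmin⟩ := Finset.exists_min_image P (fun p => toLex p) hne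
  have hpos : ∀ p ∈ P, p ≠ x → (0 < p.1 - x.1 ∨ (p.1 - x.1 = 0 ∧ 0 < p.2 - x.2)) := by
    intro p hp hpx
    have h := hmin p hp
    rw [Prod.Lex.toLex_le_toLex] at h
    rcases h with h | ⟨h, h'⟩
    · left; linarith
    · right
      refine ⟨by linarith, ?_⟩
      rcases h'.lt_or_eq with h2 | h2
      · linarith
      · exact absurd (Prod.ext h.symm h2.symm) hpx
  have hnz : ∀ p ∈ P, ∀ q ∈ P, p ≠ x → q ≠ x → p ≠ q → leftOf x p q ∨ leftOf x q p := by
    intro p hp q hq hpx hqx hpq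
    by_contra hcon
    simp only [leftOf, not_or, not_lt] at hcon
    refine hgp {x, p, q} ?_ ?_ ?_
    · intro z hz
      simp only [Finset.mem_insert, Finset.mem_singleton] at hz
      rcases hz with rfl | rfl | rfl <;> assumption
    · exact Finset.card_eq_three.mpr ⟨x, p, q, hpx.symm, hqx.symm, hpq, rfl⟩
    · have := aux_coll (x := x) (p := p) (q := q) hpx (by linarith [hcon.1, hcon.2])
      simpa using this
  have hself : ∀ p, ¬ leftOf x p x := by intro p; simp [leftOf]
  have hself2 : ∀ p, ¬ leftOf x p p := by
    intro p h; simp only [leftOf] at h; linarith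
  have hlt : ∀ p ∈ P, ∀ q ∈ P, p ≠ x → q ≠ x → leftOf x p q →
      (P.filter (fun z => leftOf x q z)).card < (P.filter (fun z => leftOf x p z)).card := by
    intro p hp q hq hpx hqx h
    apply Finset.card_lt_card
    rw [Finset.ssubset_iff_of_subset]
    · exact ⟨q, by simp [hq, h], by simp [hself2]⟩
    · intro z hz
      simp only [Finset.mem_filter] at hz ⊢
      have hzx : z ≠ x := by rintro rfl; exact hself q hz.2
      exact ⟨hz.1, aux_trans (hpos p hp hpx) (hpos q hq hqx) (hpos z hz.1 hzx) h hz.2⟩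
  have hcardE : (P.erase x).card = n - 1 := by rw [Finset.card_erase_of_mem hx, hcard]
  have hmaps : Set.MapsTo (fun y => (P.filter (fun z => leftOf x y z)).card)
      (P.erase x : Finset Pt) (Finset.range (n - 1) : Finset ℕ) := by
    intro y hy
    have hy' := Finset.mem_erase.mp (Finset.mem_coe.mp hy)
    simp only [Finset.coe_range, Set.mem_Iio]
    rw [← hcardE]
    apply Finset.card_lt_card
    rw [Finset.ssubset_iff_of_subset]
    · exact ⟨y, Finset.mem_coe.mp hy, by simp [hself2]⟩
    · intro z hz
      simp only [Finset.mem_filter] at hz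
      refine Finset.mem_erase.mpr ⟨?_, hz.1⟩
      rintro rfl; exact hself y hz.2
  have hinj : Set.InjOn (fun y => (P.filter (fun z => leftOf x y z)).card)
      (P.erase x : Finset Pt) := by
    intro p hp q hq hpq
    have hp' := Finset.mem_erase.mp (Finset.mem_coe.mp hp)
    have hq' := Finset.mem_erase.mp (Finset.mem_coe.mp hq)
    by_contra hne
    simp only at hpq
    rcases hnz p hp'.2 q hq'.2 hp'.1 hq'.1 hne with h | h
    · have := hlt p hp'.2 q hq'.2 hp'.1 hq'.1 h
      omega
    · have := hlt q hq'.2 p hp'.2 hq'.1 hp'.1 h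
      omega
  have hsurj := Finset.surjOn_of_injOn_of_card_le _ hmaps hinj (by simp [hcardE])
  obtain ⟨y, hy, hyj⟩ := hsurj (show j ∈ ((Finset.range (n - 1) : Finset ℕ) : Set ℕ) by
    simp; omega)
  have hy' := Finset.mem_erase.mp (Finset.mem_coe.mp hy)
  exact ⟨x, hx, y, hy'.2, hy'.1.symm, hx, hy'.2, hy'.1.symm, hyj⟩
end
end

section
/- Let k, s be integers with 3 ≤ k ≤ s − 1, and let P be a set of n > 2s − 2 points in general position in the plane ℝ². Let (a, a′) be an (s−1)-edge of P and let D be a k-hole of P with D ⊆ L(aa′). Then there exist distinct points b, b′ ∈ P such that (b, b′) is an (s−1)-edge of P, b is a point of D, and the other k − 1 points of D all lie in L(bb′). -/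
open scoped Classical

noncomputable section

def s6y (a a' p : Pt) : ℝ := (a'.1 - a.1) * (p.2 - a.2) - (a'.2 - a.2) * (p.1 - a.1)

def s6x (a a' p : Pt) : ℝ := (a'.1 - a.1) * p.1 + (a'.2 - a.2) * p.2

def s6l (a a' p : Pt) (t : ℝ) : ℝ := s6x a a' p - t * s6y a a' p

theorem s6l_cont (a a' p : Pt) : Continuous (s6l a a' p) := by
  unfold s6l; fun_prop

theorem s6_gp (P : Finset Pt) (hgp : GenPos P) (b q p : Pt) (hb : b ∈ P) (hq : q ∈ P)
    (hp : p ∈ P) (hbq : b ≠ q) (hbp : b ≠ p) (hqp : q ≠ p) :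
    (q.1 - b.1) * (p.2 - b.2) - (q.2 - b.2) * (p.1 - b.1) ≠ 0 := by
  intro h
  refine hgp {b, q, p} ?_ ?_ ?_
  · intro z hz
    simp only [Finset.mem_insert, Finset.mem_singleton] at hz
    rcases hz with rfl | rfl | rfl <;> assumption
  · exact Finset.card_eq_three.mpr ⟨b, q, p, hbq, hbp, hqp, rfl⟩
  · have hN : (q.1 - b.1) ^ 2 + (q.2 - b.2) ^ 2 ≠ 0 := by
      intro h0
      apply hbq
      have h1 : q.1 - b.1 = 0 := by nlinarith [sq_nonneg (q.1 - b.1), sq_nonneg (q.2 - b.2)]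
      have h2 : q.2 - b.2 = 0 := by nlinarith [sq_nonneg (q.1 - b.1), sq_nonneg (q.2 - b.2)]
      exact Prod.ext (by linarith) (by linarith)
    rw [collinear_iff_of_mem (p₀ := b) (by simp)]
    refine ⟨q - b, ?_⟩
    intro z hz
    simp only [Finset.coe_insert, Finset.coe_singleton, Set.mem_insert_iff,
      Set.mem_singleton_iff] at hz
    rcases hz with rfl | rfl | rfl
    · exact ⟨0, by simp⟩
    · exact ⟨1, by simp⟩
    · refine ⟨((q.1 - b.1) * (z.1 - b.1) + (q.2 - b.2) * (z.2 - b.2)) /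
        ((q.1 - b.1) ^ 2 + (q.2 - b.2) ^ 2), ?_⟩
      apply Prod.ext
      · simp only [vadd_eq_add, Prod.fst_add, Prod.smul_fst, Prod.fst_sub, smul_eq_mul]
        field_simp
        linear_combination (-(q.2 - b.2)) * h
      · simp only [vadd_eq_add, Prod.snd_add, Prod.smul_snd, Prod.snd_sub, smul_eq_mul]
        field_simp
        linear_combination (q.1 - b.1) * h

theorem s6_cross (a a' b q p : Pt) (T : ℝ) (h : s6l a a' q T = s6l a a' b T) :
    ((a'.1 - a.1) ^ 2 + (a'.2 - a.2) ^ 2) *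
      ((q.1 - b.1) * (p.2 - b.2) - (q.2 - b.2) * (p.1 - b.1)) =
    (s6y a a' b - s6y a a' q) * (s6l a a' p T - s6l a a' b T) := by
  have h1 : s6x a a' q - s6x a a' b = T * (s6y a a' q - s6y a a' b) := by
    unfold s6l at h; linarith
  have h2 : ((a'.1 - a.1) ^ 2 + (a'.2 - a.2) ^ 2) *
      ((q.1 - b.1) * (p.2 - b.2) - (q.2 - b.2) * (p.1 - b.1)) =
      (s6x a a' q - s6x a a' b) * (s6y a a' p - s6y a a' b)
      - (s6y a a' q - s6y a a' b) * (s6x a a' p - s6x a a' b) := by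
    unfold s6x s6y; ring
  rw [h2, h1]; unfold s6l; ring

def s6A (a a' : Pt) (P D : Finset Pt) (t : ℝ) : Finset Pt :=
  (P \ D).filter (fun p => ∃ d ∈ D, s6l a a' d t < s6l a a' p t)

theorem s6_open (a a' : Pt) (P D : Finset Pt) (T : ℝ) :
    ∀ᶠ t in nhds T, s6A a a' P D T ⊆ s6A a a' P D t := by
  have : ∀ p ∈ s6A a a' P D T, ∀ᶠ t in nhds T, p ∈ s6A a a' P D t := by
    intro p hp
    simp only [s6A, Finset.mem_filter] at hp ⊢
    obtain ⟨hpP, d, hd, hlt⟩ := hp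
    filter_upwards [(s6l_cont a a' d).continuousAt.eventually_lt
      (s6l_cont a a' p).continuousAt hlt] with t ht
    exact ⟨hpP, d, hd, ht⟩
  exact (Filter.eventually_all_finset _).mpr this

theorem s6_far (a a' p d : Pt) (hp : s6y a a' p ≤ 0) (hd : 0 < s6y a a' d) :
    (∀ᶠ t in Filter.atBot, s6l a a' p t ≤ s6l a a' d t) ∧
    (∀ᶠ t in Filter.atTop, s6l a a' d t < s6l a a' p t) := by
  have hy : 0 < s6y a a' d - s6y a a' p := by linarith
  constructor
  · filter_upwards [Filter.eventually_le_atBot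
      ((s6x a a' d - s6x a a' p) / (s6y a a' d - s6y a a' p))] with t ht
    rw [le_div_iff₀ hy] at ht
    unfold s6l; linarith
  · filter_upwards [Filter.eventually_gt_atTop
      ((s6x a a' d - s6x a a' p) / (s6y a a' d - s6y a a' p))] with t ht
    rw [div_lt_iff₀ hy] at ht
    unfold s6l; linarith

/-- given an `(s−1)`-edge `(a, a′)` and a `k`-hole `D ⊆ L(aa′)`, there is an
`(s−1)`-edge `(b, b′)` with `b ∈ D` and all other points of `D` in `L(bb′)`. -/
theorem stmt_6 (k s : ℕ) (hk : 3 ≤ k) (hks : k + 1 ≤ s)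
    (P : Finset Pt) (hcard : 2 * s - 2 < P.card) (hgp : GenPos P)
    (a a' : Pt) (haa' : IsJEdge (s - 1) P a a')
    (D : Finset Pt) (hD : IsHole k P D) (hDL : ∀ p ∈ D, leftOf a a' p) :
    ∃ b b' : Pt, b ≠ b' ∧ IsJEdge (s - 1) P b b' ∧ b ∈ D ∧
      ∀ p ∈ D, p ≠ b → leftOf b b' p := by
  obtain ⟨haP, haP', hne, hcnt⟩ := haa'
  obtain ⟨hDP, hDk, -, -⟩ := hD
  have hNpos : 0 < (a'.1 - a.1) ^ 2 + (a'.2 - a.2) ^ 2 := by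
    by_contra h0
    apply hne
    have h1 : a'.1 - a.1 = 0 := by nlinarith [sq_nonneg (a'.1 - a.1), sq_nonneg (a'.2 - a.2)]
    have h2 : a'.2 - a.2 = 0 := by nlinarith [sq_nonneg (a'.1 - a.1), sq_nonneg (a'.2 - a.2)]
    exact Prod.ext (by linarith) (by linarith)
  have hDne : D.Nonempty := Finset.card_pos.mp (by omega)
  obtain ⟨d0, hd0⟩ := hDne
  have hDy : ∀ d ∈ D, 0 < s6y a a' d := hDL
  set F := P.filter (fun p => leftOf a a' p) with hF
  have hDF : D ⊆ F := fun d hd => Finset.mem_filter.mpr ⟨hDP hd, hDL d hd⟩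
  have hFP : F ⊆ P := Finset.filter_subset _ _
  have hyF : ∀ p ∈ P, p ∉ F → s6y a a' p ≤ 0 := by
    intro p hp hpF
    by_contra hc
    exact hpF (Finset.mem_filter.mpr ⟨hp, not_le.mp hc⟩)
  have hfar : ∀ p ∈ P \ F, ∀ d ∈ D, (∀ᶠ t in Filter.atBot, s6l a a' p t ≤ s6l a a' d t) ∧
    (∀ᶠ t in Filter.atTop, s6l a a' d t < s6l a a' p t) := fun p hp d hd =>
    s6_far a a' p d (hyF p (Finset.mem_sdiff.mp hp).1 (Finset.mem_sdiff.mp hp).2) (hDy d hd)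
  have hbot : ∀ᶠ t in Filter.atBot, ∀ p ∈ P \ F, ∀ d ∈ D, s6l a a' p t ≤ s6l a a' d t :=
    (Filter.eventually_all_finset _).mpr fun p hp =>
      (Filter.eventually_all_finset _).mpr fun d hd => (hfar p hp d hd).1
  have htop : ∀ᶠ t in Filter.atTop, ∀ p ∈ P \ F, s6l a a' d0 t < s6l a a' p t :=
    (Filter.eventually_all_finset _).mpr fun p hp => (hfar p hp d0 hd0).2
  set S : Set ℝ := {t | (s6A a a' P D t).card ≤ s - k} with hS
  have hSne : S.Nonempty := by
    obtain ⟨t, ht⟩ := hbot.exists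
    refine ⟨t, ?_⟩
    have hsub : s6A a a' P D t ⊆ F \ D := by
      intro p hp
      simp only [s6A, Finset.mem_filter, Finset.mem_sdiff] at hp
      obtain ⟨⟨hpP, hpD⟩, d, hd, hlt⟩ := hp
      refine Finset.mem_sdiff.mpr ⟨?_, hpD⟩
      by_contra hpF
      exact absurd (ht p (Finset.mem_sdiff.mpr ⟨hpP, hpF⟩) d hd) (not_le.mpr hlt)
    have h1 := Finset.card_le_card hsub
    rw [Finset.card_sdiff_of_subset hDF] at h1
    change (s6A a a' P D t).card ≤ s - k
    omega
  have hSb : BddAbove S := by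
    obtain ⟨M, hM⟩ := Filter.eventually_atTop.mp htop
    refine ⟨M, fun t ht => ?_⟩
    by_contra hc
    have h2 := hM t (not_le.mp hc).le
    have hsub : P \ F ⊆ s6A a a' P D t := by
      intro p hp
      have hp' := Finset.mem_sdiff.mp hp
      exact Finset.mem_filter.mpr ⟨Finset.mem_sdiff.mpr ⟨hp'.1, fun h => hp'.2 (hDF h)⟩,
        d0, hd0, h2 p hp⟩
    have h1 := Finset.card_le_card hsub
    rw [Finset.card_sdiff_of_subset hFP] at h1
    have h3 : (s6A a a' P D t).card ≤ s - k := ht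
    omega
  have hSc : IsClosed S := by
    rw [← isOpen_compl_iff, isOpen_iff_mem_nhds]
    intro t ht
    filter_upwards [s6_open a a' P D t] with r hr
    have h1 := Finset.card_le_card hr
    simp only [hS, Set.mem_compl_iff, Set.mem_ofPred_eq] at ht ⊢
    omega
  obtain ⟨T, hTdef⟩ : ∃ T, T = sSup S := ⟨_, rfl⟩
  have hTS : (s6A a a' P D T).card ≤ s - k := by
    have := hSc.csSup_mem hSne hSb
    rw [← hTdef] at this
    exact this
  have hTgt : ∀ t, T < t → s - k < (s6A a a' P D t).card := by
    intro t ht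
    by_contra hc
    have := le_csSup hSb (show t ∈ S from not_lt.mp hc)
    linarith
  -- strict inequalities persist near T
  have hpers : ∀ᶠ t in nhds T, ∀ p ∈ P, ∀ r ∈ P, s6l a a' p T < s6l a a' r T →
      s6l a a' p t < s6l a a' r t := by
    refine (Filter.eventually_all_finset _).mpr fun p hp =>
      (Filter.eventually_all_finset _).mpr fun r hr => ?_
    by_cases h : s6l a a' p T < s6l a a' r T
    · filter_upwards [(s6l_cont a a' p).continuousAt.eventually_lt
        (s6l_cont a a' r).continuousAt h] with t ht _
      exact ht
    · exact Filter.Eventually.of_forall fun t h' => absurd h' h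
  obtain ⟨t, htp, htT⟩ : ∃ t, (∀ p ∈ P, ∀ r ∈ P, s6l a a' p T < s6l a a' r T →
      s6l a a' p t < s6l a a' r t) ∧ T < t := by
    have h1 := (hpers.filter_mono (nhdsWithin_le_nhds (s := Set.Ioi T))).and
      (self_mem_nhdsWithin : Set.Ioi T ∈ nhdsWithin T (Set.Ioi T))
    exact h1.exists
  have hgt := hTgt t htT
  obtain ⟨q, hqt, hqT⟩ : ∃ q ∈ s6A a a' P D t, q ∉ s6A a a' P D T := by
    by_contra hc
    push Not at hc
    have := Finset.card_le_card (show s6A a a' P D t ⊆ s6A a a' P D T from hc)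
    omega
  have key : ∀ p ∈ s6A a a' P D t, p ∉ s6A a a' P D T → p ∈ P ∧ p ∉ D ∧
      (∀ d ∈ D, s6l a a' p T ≤ s6l a a' d T) ∧
      ∃ d ∈ D, s6l a a' d t < s6l a a' p t ∧ s6l a a' p T = s6l a a' d T := by
    intro p hp hpn
    simp only [s6A, Finset.mem_filter, Finset.mem_sdiff] at hp hpn
    obtain ⟨⟨hpP, hpD⟩, d, hd, hlt⟩ := hp
    have hle : ∀ d ∈ D, s6l a a' p T ≤ s6l a a' d T := by
      intro d hd
      by_contra hc
      exact hpn ⟨⟨hpP, hpD⟩, d, hd, not_le.mp hc⟩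
    refine ⟨hpP, hpD, hle, d, hd, hlt, ?_⟩
    rcases (hle d hd).lt_or_eq with h | h
    · exact absurd (htp p hpP d (hDP hd) h) (not_lt.mpr hlt.le)
    · exact h
  obtain ⟨hqP, hqD, hqle, b, hbD, hbt, hqb⟩ := key q hqt hqT
  have hbP := hDP hbD
  have hbq : b ≠ q := fun h => hqD (h ▸ hbD)
  have hyy : 0 < s6y a a' b - s6y a a' q := by
    unfold s6l at hbt hqb
    have h1 : 0 < (t - T) * (s6y a a' b - s6y a a' q) := by nlinarith
    exact pos_of_mul_pos_right h1 (by linarith)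
  have hleft : ∀ p, leftOf b q p ↔ s6l a a' b T < s6l a a' p T := by
    intro p
    have h1 := s6_cross a a' b q p T hqb
    unfold leftOf
    rw [← mul_pos_iff_of_pos_left hNpos, h1, mul_pos_iff_of_pos_left hyy, sub_pos]
  have huniq : ∀ p ∈ P, s6l a a' p T = s6l a a' b T → p = b ∨ p = q := by
    intro p hp h
    by_contra hc
    push Not at hc
    have h1 := s6_cross a a' b q p T hqb
    rw [h, sub_self, mul_zero] at h1
    rcases mul_eq_zero.mp h1 with h2 | h2
    · exact hNpos.ne' h2
    · exact s6_gp P hgp b q p hbP hqP hp hbq hc.1.symm hc.2.symm h2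
  have hDleft : ∀ p ∈ D, p ≠ b → s6l a a' b T < s6l a a' p T := by
    intro p hp hpb
    rw [← hqb]
    refine lt_of_le_of_ne (hqle p hp) fun h => ?_
    rcases huniq p (hDP hp) (by rw [← h, hqb]) with h | h
    · exact hpb h
    · exact hqD (h ▸ hp)
  have hcardT : (s6A a a' P D T).card = s - k := by
    have hsub : s6A a a' P D t ⊆ insert q (s6A a a' P D T) := by
      intro p hp
      by_cases hpT : p ∈ s6A a a' P D T
      · exact Finset.mem_insert_of_mem hpT
      · obtain ⟨hpP, hpD, hple, d, hdD, -, hpd⟩ := key p hp hpT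
        have h1 : s6l a a' p T = s6l a a' b T :=
          le_antisymm (hple b hbD) (by rw [hpd, ← hqb]; exact hqle d hdD)
        rcases huniq p hpP h1 with h | h
        · exact absurd (h ▸ hbD) hpD
        · rw [h]; exact Finset.mem_insert_self _ _
    have h1 := Finset.card_le_card hsub
    have h2 := Finset.card_insert_le q (s6A a a' P D T)
    omega
  refine ⟨b, q, hbq, ⟨hbP, hqP, hbq, ?_⟩, hbD, fun p hp hpb => (hleft p).mpr (hDleft p hp hpb)⟩
  have hEq : P.filter (fun p => leftOf b q p) = D.erase b ∪ s6A a a' P D T := by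
    ext p
    simp only [Finset.mem_filter, Finset.mem_union, Finset.mem_erase, s6A, Finset.mem_sdiff, hleft]
    constructor
    · rintro ⟨hpP, hlt⟩
      by_cases hpD : p ∈ D
      · exact Or.inl ⟨fun h => by rw [h] at hlt; exact lt_irrefl _ hlt, hpD⟩
      · exact Or.inr ⟨⟨hpP, hpD⟩, b, hbD, hlt⟩
    · rintro (⟨h1, h2⟩ | ⟨⟨h1, h2⟩, d, hd, hlt⟩)
      · exact ⟨hDP h2, hDleft p h2 h1⟩
      · exact ⟨h1, by rw [← hqb]; exact lt_of_le_of_lt (hqle d hd) hlt⟩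
  have hdisj : Disjoint (D.erase b) (s6A a a' P D T) := by
    rw [Finset.disjoint_left]
    intro p hp hp2
    simp only [s6A, Finset.mem_filter, Finset.mem_sdiff] at hp2
    exact hp2.1.2 (Finset.mem_of_mem_erase hp)
  have h3 := Finset.card_union_of_disjoint hdisj
  rw [Finset.card_erase_of_mem hbD, hcardT, hDk] at h3
  have h4 : (P.filter (fun p => leftOf b q p)).card = (k - 1) + (s - k) := by
    rw [hEq]; exact h3
  rw [h4]
  omega
end
end
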